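/- An isothermic surface (Λ,η) in S^n is a special isothermic surface of type 0 if and only if Λ is not full, i.e., if and only if the image of Λ is contained in an (n−1)-dimensional subsphere P(L ∩ W) for some (n,1)-plane W = ⟨p_0⟩^⊥ with p_0 a nonzero spacelike vector of ℝ^{n+1,1}. -/

import Mathlib

noncomputable section

open Finset

/-- Minkowski space `ℝ^{n+1,1}`, modelled on `Fin (n+2) → ℝ`. -/
abbrev MV (n : ℕ) : Type := EuclideanSpace ℝ (Fin (n + 2))

/-- The Minkowski inner product of signature `(n+1,1)`. -/
def mink (n : ℕ) (x y : MV n) : ℝ :=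
  ∑ i : Fin (n + 1), x i.castSucc * y i.castSucc
    - x (Fin.last (n + 1)) * y (Fin.last (n + 1))

/-- The light cone `L ⊂ ℝ^{n+1,1}`. -/
def LightCone (n : ℕ) : Set (MV n) := {v | v ≠ 0 ∧ mink n v v = 0}

/-- The skew endomorphism `u ∧ v`, acting by `(u ∧ v) w = (u,w)v − (v,w)u`. -/
def wedge (n : ℕ) (u v w : MV n) : MV n :=
  mink n u w • v - mink n v w • u

/-- The surface domain: a two-dimensional coordinate chart. -/
abbrev Surf : Type := ℝ × ℝ

/-- the coordinate direction ∂/∂u -/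
def du : Surf := (1, 0)

/-- the coordinate direction ∂/∂v -/
def dv : Surf := (0, 1)

/-- partial derivative of a section in a coordinate direction -/
def pd {n : ℕ} (e : Surf) (f : Surf → MV n) (x : Surf) : MV n :=
  fderiv ℝ f x e

lemma mink_add_left (n : ℕ) (a b c : MV n) :
    mink n (a + b) c = mink n a c + mink n b c := by
  simp [mink, PiLp.add_apply, add_mul, Finset.sum_add_distrib]; ring

lemma mink_smul_left (n : ℕ) (r : ℝ) (a c : MV n) :
    mink n (r • a) c = r * mink n a c := by
  simp [mink, PiLp.smul_apply, smul_eq_mul, mul_sub, Finset.mul_sum, mul_assoc]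

lemma mink_zero_left (n : ℕ) (c : MV n) : mink n 0 c = 0 := by
  simp [mink]

/-- An isothermic surface `(Λ,η)` in `S^n = P(L)`, given by a nowhere-zero null
lift `F` of the immersion `Λ` together with the 1-form
`η = F ∧ W₁ du + F ∧ W₂ dv` with values in `Λ ∧ Λ^⊥`. -/
structure IsothermicSurface (n : ℕ) : Type where
  F : Surf → MV n
  W₁ : Surf → MV n
  W₂ : Surf → MV n
  smooth_F : ContDiff ℝ (⊤ : ℕ∞) F
  smooth_W₁ : ContDiff ℝ (⊤ : ℕ∞) W₁
  smooth_W₂ : ContDiff ℝ (⊤ : ℕ∞) W₂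
  F_ne : ∀ x, F x ≠ 0
  F_null : ∀ x, mink n (F x) (F x) = 0
  immersed : ∀ x, LinearIndependent ℝ ![F x, pd du F x, pd dv F x]
  W₁_perp : ∀ x, mink n (F x) (W₁ x) = 0
  W₂_perp : ∀ x, mink n (F x) (W₂ x) = 0
  eta_ne : ∃ x z, wedge n (F x) (W₁ x) z ≠ 0 ∨ wedge n (F x) (W₂ x) z ≠ 0
  eta_closed : ∀ x z,
    fderiv ℝ (fun y => wedge n (F y) (W₂ y) z) x du
      = fderiv ℝ (fun y => wedge n (F y) (W₁ y) z) x dv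

/-- `s` is a parallel section for the flat connection `∇^t = d + tη`. -/
def ParallelSection (n : ℕ) (S : IsothermicSurface n) (t : ℝ)
    (s : Surf → MV n) : Prop :=
  ∀ x, fderiv ℝ s x du + t • wedge n (S.F x) (S.W₁ x) (s x) = 0
     ∧ fderiv ℝ s x dv + t • wedge n (S.F x) (S.W₂ x) (s x) = 0

/-- A polynomial conserved quantity of degree `d` of the isothermic surface
`(Λ,η)`: a polynomial `p(t) = Σ_{k=0}^d p_k t^k` of (smooth) sections, of exact
degree `d`, with `∇^t p(t) = 0` for all `t`. -/
structure PolyConservedQuantity (n : ℕ) (S : IsothermicSurface n) (d : ℕ) : Type where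
  coeff : ℕ → Surf → MV n
  smooth : ∀ k, ContDiff ℝ (⊤ : ℕ∞) (coeff k)
  coeff_eq_zero : ∀ k, d < k → coeff k = 0
  top_ne : coeff d ≠ 0
  conserved : ∀ t : ℝ, ParallelSection n S t
    (fun x => ∑ k ∈ Finset.range (d + 1), t ^ k • coeff k x)

/-- evaluation `p(t)` of a polynomial conserved quantity -/
def pcEval {n : ℕ} {S : IsothermicSurface n} {d : ℕ}
    (p : PolyConservedQuantity n S d) (t : ℝ) (x : Surf) : MV n :=
  ∑ k ∈ Finset.range (d + 1), t ^ k • p.coeff k x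

/-- `(Λ,η)` is a special isothermic surface of type `d`. -/
def SpecialOfType (n : ℕ) (S : IsothermicSurface n) (d : ℕ) : Prop :=
  Nonempty (PolyConservedQuantity n S d)

/-- `p₀ ∈ ⟨w⟩`: the polynomial conserved quantity exhibits `(Λ,η)` as special
isothermic in the space-form `E(w)`. -/
def InSpaceForm {n : ℕ} {S : IsothermicSurface n} {d : ℕ}
    (p : PolyConservedQuantity n S d) (w : MV n) : Prop :=
  ∃ c : ℝ, ∀ x, p.coeff 0 x = c • w

/-- fullness: the image of `Λ` lies in no proper subsphere -/
def Full (n : ℕ) (S : IsothermicSurface n) : Prop :=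
  ¬ ∃ p : MV n, p ≠ 0 ∧ ∀ x, mink n p (S.F x) = 0
/-- A Darboux transform `Λ̂` of `(Λ,η)` with parameter `m`, given by a
`∇^m`-parallel null lift `G` spanning an immersed surface with `Λ̂ ∩ Λ = 0`. -/
structure DarbouxTransform (n : ℕ) (S : IsothermicSurface n) (m : ℝ) : Type where
  G : Surf → MV n
  smooth_G : ContDiff ℝ (⊤ : ℕ∞) G
  G_ne : ∀ x, G x ≠ 0
  G_null : ∀ x, mink n (G x) (G x) = 0
  immersed : ∀ x, LinearIndependent ℝ ![G x, pd du G x, pd dv G x]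
  disjoint : ∀ x, G x ∉ Submodule.span ℝ {S.F x}
  parallel : ParallelSection n S m G

/-- The gauge transformation `Γ_{⟨F⟩}^{⟨G⟩}(c)`: acts as `c` on `⟨G⟩`, as `1` on
`(⟨F⟩ ⊕ ⟨G⟩)^⊥` and as `c⁻¹` on `⟨F⟩`. -/
def gaugeG (n : ℕ) (F G : MV n) (c : ℝ) (z : MV n) : MV n :=
  ((mink n G z / mink n F G) / c) • F
    + (c * (mink n F z / mink n F G)) • G
    + (z - (mink n G z / mink n F G) • F - (mink n F z / mink n F G) • G)

/-- `Γ_Λ^{Λ̂}(1 − t/m) · (d + tη) = d + tη̂` for all `t ≠ m`: the gauge relation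
between the pencils of flat connections of an isothermic surface `S` and of (an
isothermic structure `T` on) its Darboux transform with parameter `m`. -/
def GaugeRel (n : ℕ) (S T : IsothermicSurface n) (m : ℝ) : Prop :=
  ∀ t : ℝ, t ≠ m → ∀ s : Surf → MV n, ContDiff ℝ (⊤ : ℕ∞) s → ∀ x : Surf,
    (fderiv ℝ (fun y => gaugeG n (S.F y) (T.F y) (1 - t / m) (s y)) x du
        + t • wedge n (T.F x) (T.W₁ x) (gaugeG n (S.F x) (T.F x) (1 - t / m) (s x))
      = gaugeG n (S.F x) (T.F x) (1 - t / m)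
          (fderiv ℝ s x du + t • wedge n (S.F x) (S.W₁ x) (s x)))
    ∧ (fderiv ℝ (fun y => gaugeG n (S.F y) (T.F y) (1 - t / m) (s y)) x dv
        + t • wedge n (T.F x) (T.W₂ x) (gaugeG n (S.F x) (T.F x) (1 - t / m) (s x))
      = gaugeG n (S.F x) (T.F x) (1 - t / m)
          (fderiv ℝ s x dv + t • wedge n (S.F x) (S.W₂ x) (s x)))

/-- `Λ̂ = ⟨p(m)⟩` with `(p(m),p(m)) = 0`: the Darboux transform `D` is a
complementary surface of `(Λ,η)` with respect to `p(t)`. -/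
def IsComplementary (n : ℕ) {S : IsothermicSurface n} {d : ℕ}
    (p : PolyConservedQuantity n S d) {m : ℝ} (D : DarbouxTransform n S m) : Prop :=
  (∀ x, mink n (pcEval p m x) (pcEval p m x) = 0) ∧
  (∀ x, Submodule.span ℝ {D.G x} = Submodule.span ℝ {pcEval p m x})

/-- `m` is a repeated root of the (constant-coefficient) polynomial `(p(t),p(t))`. -/
def IsRepeatedRootAt {n : ℕ} {S : IsothermicSurface n} {d : ℕ}
    (p : PolyConservedQuantity n S d) (m : ℝ) : Prop :=
  ∀ x, mink n (pcEval p m x) (pcEval p m x) = 0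
    ∧ deriv (fun t : ℝ => mink n (pcEval p t x) (pcEval p t x)) m = 0
/-- metric coefficient `g₁₁ = (F_u,F_u)` of the induced metric -/
def gUU (n : ℕ) (F : Surf → MV n) (x : Surf) : ℝ := mink n (pd du F x) (pd du F x)

/-- metric coefficient `g₁₂ = (F_u,F_v)` -/
def gUV (n : ℕ) (F : Surf → MV n) (x : Surf) : ℝ := mink n (pd du F x) (pd dv F x)

/-- metric coefficient `g₂₂ = (F_v,F_v)` -/
def gVV (n : ℕ) (F : Surf → MV n) (x : Surf) : ℝ := mink n (pd dv F x) (pd dv F x)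

/-- `(𝐇, N)`, the inner product of the mean curvature vector of `F` (in a
space-form `E(w)`) with a normal field `N`: half the trace with respect to the
induced metric of the `N`-component of the second fundamental form. -/
def meanCurv (n : ℕ) (F N : Surf → MV n) (x : Surf) : ℝ :=
  (gVV n F x * mink n (pd du (pd du F) x) (N x)
    - 2 * gUV n F x * mink n (pd du (pd dv F) x) (N x)
    + gUU n F x * mink n (pd dv (pd dv F) x) (N x))
  / (2 * (gUU n F x * gVV n F x - gUV n F x ^ 2))

/-- `N` is a unit normal field of the lift `F : Σ → E(w)`. -/
def IsUnitNormal (n : ℕ) (F N : Surf → MV n) (w : MV n) : Prop :=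
  (∀ x, mink n (N x) (N x) = 1) ∧ (∀ x, mink n (N x) w = 0)
    ∧ (∀ x, mink n (N x) (F x) = 0)
    ∧ (∀ x, mink n (N x) (pd du F x) = 0) ∧ (∀ x, mink n (N x) (pd dv F x) = 0)

/-- `N` is parallel for the normal connection of `F : Σ → E(w)`: the derivative
of `N` has no component in the normal bundle of `F` in `E(w)`. -/
def ParallelNormal (n : ℕ) (F N : Surf → MV n) (w : MV n) : Prop :=
  ∀ x e, fderiv ℝ N x e ∈ Submodule.span ℝ {F x, pd du F x, pd dv F x, w}

/-- the chart coordinates `(u,v)` are conformal curvature line coordinates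
corresponding to `η`, with conformal factor `e^{2θ}`:
`I = e^{2θ}(du² + dv²)` and `η = e^{−2θ} F ∧ (−F_u du + F_v dv)`. -/
def ConformalCoords (n : ℕ) (S : IsothermicSurface n) (θ : Surf → ℝ) : Prop :=
  ContDiff ℝ (⊤ : ℕ∞) θ
  ∧ (∀ x, mink n (pd du S.F x) (pd du S.F x) = Real.exp (2 * θ x))
  ∧ (∀ x, mink n (pd dv S.F x) (pd dv S.F x) = Real.exp (2 * θ x))
  ∧ (∀ x, mink n (pd du S.F x) (pd dv S.F x) = 0)
  ∧ (∀ x z, wedge n (S.F x) (S.W₁ x) z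
      = Real.exp (-(2 * θ x)) • wedge n (S.F x) (-pd du S.F x) z)
  ∧ (∀ x z, wedge n (S.F x) (S.W₂ x) z
      = Real.exp (-(2 * θ x)) • wedge n (S.F x) (pd dv S.F x) z)

/-- the second fundamental form of the lift `F` in `E(w)` with respect to the
unit normal `N` is `II = e^{2θ}(k₁ du² + k₂ dv²)`. -/
def PrincipalCurvatures (n : ℕ) (S : IsothermicSurface n) (N : Surf → MV n)
    (θ k₁ k₂ : Surf → ℝ) : Prop :=
  (∀ x, mink n (pd du (pd du S.F) x) (N x) = Real.exp (2 * θ x) * k₁ x)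
  ∧ (∀ x, mink n (pd du (pd dv S.F) x) (N x) = 0)
  ∧ (∀ x, mink n (pd dv (pd dv S.F) x) (N x) = Real.exp (2 * θ x) * k₂ x)

/-- partial derivative of a real function on the surface -/
def pdR (e : Surf) (f : Surf → ℝ) (x : Surf) : ℝ := fderiv ℝ f x e
/-- `(Λ^c, η^c)` is the Christoffel transform of `(Λ,η)` with respect to the
pair `(v∞, v₀)`, witnessed by the stereoprojections `f`, `f^c` into
`ℝ^n = ⟨v₀,v∞⟩^⊥`:  `F = exp(f ∧ v∞)v₀`, `F^c = exp(f^c ∧ v₀)v∞`,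
`η = Ad(exp(f ∧ v∞))(df^c ∧ v₀)` and `η^c = Ad(exp(f^c ∧ v₀))(df ∧ v∞)`. -/
def IsChristoffelPair (n : ℕ) (S Sc : IsothermicSurface n) (vinf v0 : MV n)
    (f fc : Surf → MV n) : Prop :=
  vinf ∈ LightCone n ∧ v0 ∈ LightCone n ∧ mink n v0 vinf = -1
  ∧ ContDiff ℝ (⊤ : ℕ∞) f ∧ ContDiff ℝ (⊤ : ℕ∞) fc
  ∧ (∀ x, mink n (f x) v0 = 0) ∧ (∀ x, mink n (f x) vinf = 0)
  ∧ (∀ x, mink n (fc x) v0 = 0) ∧ (∀ x, mink n (fc x) vinf = 0)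
  ∧ (∀ x, S.F x = v0 + f x + (mink n (f x) (f x) / 2) • vinf)
  ∧ (∀ x, Sc.F x = vinf + fc x + (mink n (fc x) (fc x) / 2) • v0)
  ∧ (∀ x z, wedge n (S.F x) (S.W₁ x) z
      = wedge n (pd du fc x + mink n (f x) (pd du fc x) • vinf) (S.F x) z)
  ∧ (∀ x z, wedge n (S.F x) (S.W₂ x) z
      = wedge n (pd dv fc x + mink n (f x) (pd dv fc x) • vinf) (S.F x) z)
  ∧ (∀ x z, wedge n (Sc.F x) (Sc.W₁ x) z
      = wedge n (pd du f x + mink n (fc x) (pd du f x) • v0) (Sc.F x) z)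
  ∧ (∀ x z, wedge n (Sc.F x) (Sc.W₂ x) z
      = wedge n (pd dv f x + mink n (fc x) (pd dv f x) • v0) (Sc.F x) z)

/-- `Φ` is an orthogonal gauge transformation with `Φ · (d + sη) = d`. -/
def IsTGauge (n : ℕ) (S : IsothermicSurface n) (s : ℝ)
    (Φ : Surf → MV n → MV n) : Prop :=
  (∀ x, IsLinearMap ℝ (Φ x))
  ∧ (∀ x z z', mink n (Φ x z) (Φ x z') = mink n z z')
  ∧ (∀ σ : Surf → MV n, ContDiff ℝ (⊤ : ℕ∞) σ → ∀ x,
      (fderiv ℝ (fun y => Φ y (σ y)) x du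
         = Φ x (fderiv ℝ σ x du + s • wedge n (S.F x) (S.W₁ x) (σ x)))
      ∧ (fderiv ℝ (fun y => Φ y (σ y)) x dv
         = Φ x (fderiv ℝ σ x dv + s • wedge n (S.F x) (S.W₂ x) (σ x))))

/-- `(Λ_s, η_s)` is the T-transform of `(Λ,η)` associated to `Φ_s`:
`Λ_s = Φ_s Λ` and `η_s = Ad(Φ_s) η`. -/
def IsTTransform (n : ℕ) (S : IsothermicSurface n) (s : ℝ)
    (Φ : Surf → MV n → MV n) (Ss : IsothermicSurface n) : Prop :=
  IsTGauge n S s Φ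
  ∧ (∀ x, Ss.F x = Φ x (S.F x))
  ∧ (∀ x z, wedge n (Ss.F x) (Ss.W₁ x) (Φ x z) = Φ x (wedge n (S.F x) (S.W₁ x) z))
  ∧ (∀ x z, wedge n (Ss.F x) (Ss.W₂ x) (Φ x z) = Φ x (wedge n (S.F x) (S.W₂ x) z))

/-- orthogonal complement with respect to the Minkowski form -/
def mperp (n : ℕ) (U : Submodule ℝ (MV n)) : Submodule ℝ (MV n) where
  carrier := {v | ∀ u ∈ U, mink n v u = 0}
  add_mem' := by
    intro a b ha hb u hu
    rw [mink_add_left, ha u hu, hb u hu, add_zero]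
  zero_mem' := by
    intro u hu; exact mink_zero_left n u
  smul_mem' := by
    intro r a ha u hu
    rw [mink_smul_left, ha u hu, mul_zero]

/-- the spherical system of `Λ` and a Darboux transform `Λ̂ = ⟨G⟩`: the
`(n−2)`-sphere congruence `C = Λ ⊕ Λ̂ ⊕ V_R^⊥`, `V_R = Λ^{(1)} ⊕ Λ̂`. -/
def sphericalSystem (n : ℕ) (S : IsothermicSurface n) (G : Surf → MV n)
    (x : Surf) : Submodule ℝ (MV n) :=
  Submodule.span ℝ {S.F x, G x}
    ⊔ mperp n (Submodule.span ℝ {S.F x, pd du S.F x, pd dv S.F x, G x})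

/-- the sphere-planes congruence `P = C + ⟨w⟩` of `Λ` and `Λ̂ = ⟨G⟩` with
respect to `w`. -/
def spherePlanes (n : ℕ) (S : IsothermicSurface n) (G : Surf → MV n)
    (w : MV n) (x : Surf) : Submodule ℝ (MV n) :=
  sphericalSystem n S G x ⊔ Submodule.span ℝ {w}

lemma caccioppoli_pointwise {z zu zv g₁ g₂ p₁ p₂ q₁ q₂ l K ε s : ℝ} (hK : 0 < K)
    (hε : 0 < ε) (hl : 1 ≤ l) (hs : s = g₁ ^ 2 + g₂ ^ 2 + ε)
    (hqr : p₁ ^ 2 + q₁ ^ 2 + p₂ ^ 2 + q₂ ^ 2 ≤ K * (p₁ * q₂ - q₁ * p₂)) :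
    (z * (2 * (g₁ * p₁ + g₂ * p₂) / (s * l))) ^ 2 ≤
      4 * K * (z ^ 2 * (-(l - 1) / (s * l) ^ 2 *
          (2 * (g₁ * p₁ + g₂ * p₂) * (g₁ * q₂ - g₂ * q₁)
            - 2 * (g₁ * q₁ + g₂ * q₂) * (g₁ * p₂ - g₂ * p₁)))
        + 2 * z / (s * l) * (zu * (g₁ * q₂ - g₂ * q₁) - zv * (g₁ * p₂ - g₂ * p₁))
        + z ^ 2 / (s * l) * (2 * (p₁ * q₂ - q₁ * p₂)))
      + 4 * K ^ 2 * (zu ^ 2 + zv ^ 2) := by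
  have hs0 : 0 < s := by rw [hs]; positivity
  have hl0 : 0 < l := by linarith
  obtain ⟨w, hw⟩ : ∃ w, w = 1 / (s * l) := ⟨_, rfl⟩
  have hw1 : w * (s * l) = 1 := by rw [hw]; field_simp
  obtain ⟨J, hJ⟩ : ∃ J, J = p₁ * q₂ - q₁ * p₂ := ⟨_, rfl⟩
  obtain ⟨P, hP⟩ : ∃ P, P = g₁ * p₂ - g₂ * p₁ := ⟨_, rfl⟩
  obtain ⟨Q, hQ⟩ : ∃ Q, Q = g₁ * q₂ - g₂ * q₁ := ⟨_, rfl⟩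
  rw [← hJ] at hqr
  rw [← hP, ← hQ, ← hJ]
  have hJ0 : 0 ≤ J := by
    have : 0 ≤ K * J := le_trans (by positivity) hqr
    exact nonneg_of_mul_nonneg_right this hK
  have e1 : (z * (2 * (g₁ * p₁ + g₂ * p₂) / (s * l))) ^ 2
      = 4 * (z * w) ^ 2 * (g₁ * p₁ + g₂ * p₂) ^ 2 := by rw [hw]; ring
  have e2 : (z ^ 2 * (-(l - 1) / (s * l) ^ 2 *
          (2 * (g₁ * p₁ + g₂ * p₂) * Q - 2 * (g₁ * q₁ + g₂ * q₂) * P))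
        + 2 * z / (s * l) * (zu * Q - zv * P) + z ^ 2 / (s * l) * (2 * J))
      = 2 * (z * w) ^ 2 * (ε * l + (g₁ ^ 2 + g₂ ^ 2)) * J + 2 * (z * w) * (zu * Q - zv * P) := by
    have h3 : (2 * (g₁ * p₁ + g₂ * p₂) * Q - 2 * (g₁ * q₁ + g₂ * q₂) * P)
        = 2 * (g₁ ^ 2 + g₂ ^ 2) * J := by rw [hP, hQ, hJ]; ring
    have h4 : z ^ 2 / (s * l) = z ^ 2 * w * (w * (s * l)) := by rw [hw1, hw]; ring
    have h5 : -(l - 1) / (s * l) ^ 2 = -(l - 1) * w ^ 2 := by rw [hw]; ring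
    have h6 : 2 * z / (s * l) = 2 * (z * w) := by rw [hw]; ring
    rw [h3, h4, h5, h6, hs]; ring
  rw [e1, e2]
  have c1 : (g₁ * p₁ + g₂ * p₂) ^ 2 ≤ (g₁ ^ 2 + g₂ ^ 2) * (p₁ ^ 2 + p₂ ^ 2) := by
    nlinarith [sq_nonneg (g₁ * p₂ - g₂ * p₁)]
  have c2 : P ^ 2 + Q ^ 2 ≤ (g₁ ^ 2 + g₂ ^ 2) * (K * J) := by
    have : P ^ 2 + Q ^ 2 ≤ (g₁ ^ 2 + g₂ ^ 2) * (p₁ ^ 2 + q₁ ^ 2 + p₂ ^ 2 + q₂ ^ 2) := by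
      rw [hP, hQ]
      nlinarith [sq_nonneg (g₁ * p₁ + g₂ * p₂), sq_nonneg (g₁ * q₁ + g₂ * q₂)]
    exact this.trans (mul_le_mul_of_nonneg_left hqr (by positivity))
  have c3 : (g₁ * p₁ + g₂ * p₂) ^ 2 ≤ (g₁ ^ 2 + g₂ ^ 2) * (K * J) :=
    c1.trans (mul_le_mul_of_nonneg_left (by linarith [sq_nonneg q₁, sq_nonneg q₂]) (by positivity))
  have c4 := mul_le_mul_of_nonneg_left c3 (sq_nonneg (z * w))
  have c5 := mul_le_mul_of_nonneg_left c2 (sq_nonneg (z * w))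
  have c6 : 0 ≤ (z * w) ^ 2 * (ε * l) * (K * J) := by positivity
  linarith [sq_nonneg (z * w * Q + K * zu), sq_nonneg (z * w * P - K * zv)]

lemma fderiv_apply_comm {g : ℝ × ℝ → ℝ} (hg : ContDiff ℝ 2 g) (x d e : ℝ × ℝ) :
    fderiv ℝ (fun y => fderiv ℝ g y d) x e = fderiv ℝ (fun y => fderiv ℝ g y e) x d := by
  have hd : DifferentiableAt ℝ (fderiv ℝ g) x :=
    ((hg.fderiv_right (m := 1) (by norm_num)).differentiable (by norm_num)) x
  have key := (hg.contDiffAt (x := x)).isSymmSndFDerivAt (by simp)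
  rw [fderiv_clm_apply hd (differentiableAt_const d), fderiv_clm_apply hd (differentiableAt_const e)]
  simpa using key e d

/-- The `u`-derivative of `-log (A - log (g₁² + g₂² + ε))`. -/
def logLogDeriv (g₁ g₂ : ℝ × ℝ → ℝ) (A ε : ℝ) (x : ℝ × ℝ) : ℝ :=
  2 * (g₁ x * fderiv ℝ g₁ x (1, 0) + g₂ x * fderiv ℝ g₂ x (1, 0)) /
    ((g₁ x ^ 2 + g₂ x ^ 2 + ε) * (A - Real.log (g₁ x ^ 2 + g₂ x ^ 2 + ε)))

lemma continuous_fderiv_apply_const {g : ℝ × ℝ → ℝ} {n : WithTop ℕ∞}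
    (hg : ContDiff ℝ n g) (hn : n ≠ 0) (d : ℝ × ℝ) : Continuous fun x => fderiv ℝ g x d :=
  (hg.continuous_fderiv hn).clm_apply continuous_const

lemma logLogDeriv_continuousOn {g₁ g₂ : ℝ × ℝ → ℝ} (h₁ : ContDiff ℝ 2 g₁) (h₂ : ContDiff ℝ 2 g₂)
    {A ε : ℝ} (hε : 0 < ε) {s : Set (ℝ × ℝ)}
    (hA : ∀ x ∈ s, 1 ≤ A - Real.log (g₁ x ^ 2 + g₂ x ^ 2 + ε)) :
    ContinuousOn (logLogDeriv g₁ g₂ A ε) s := by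
  have c₁ := h₁.continuous
  have c₂ := h₂.continuous
  have p₁ := continuous_fderiv_apply_const h₁ two_ne_zero (1, 0)
  have p₂ := continuous_fderiv_apply_const h₂ two_ne_zero (1, 0)
  have hs : ∀ x, g₁ x ^ 2 + g₂ x ^ 2 + ε ≠ 0 := fun x => by positivity
  unfold logLogDeriv
  refine ContinuousOn.div (by fun_prop) (ContinuousOn.mul (by fun_prop) ?_) ?_
  · exact (continuous_const.sub (Continuous.log (by fun_prop) hs)).continuousOn
  · intro x hx
    exact mul_ne_zero (hs x) (by linarith [hA x hx])

lemma caccioppoli_logLog {g₁ g₂ : ℝ × ℝ → ℝ} (h₁ : ContDiff ℝ 2 g₁) (h₂ : ContDiff ℝ 2 g₂)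
    {K : ℝ} (hK : 0 < K) {a b : ℝ × ℝ} (hab : a ≤ b)
    (hqr : ∀ x ∈ Set.Icc a b,
      fderiv ℝ g₁ x (1, 0) ^ 2 + fderiv ℝ g₁ x (0, 1) ^ 2
        + fderiv ℝ g₂ x (1, 0) ^ 2 + fderiv ℝ g₂ x (0, 1) ^ 2
      ≤ K * (fderiv ℝ g₁ x (1, 0) * fderiv ℝ g₂ x (0, 1)
        - fderiv ℝ g₁ x (0, 1) * fderiv ℝ g₂ x (1, 0)))
    {z : ℝ × ℝ → ℝ} (hz : ContDiff ℝ 1 z)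
    (hz₁ : ∀ y, z (a.1, y) = 0) (hz₂ : ∀ y, z (b.1, y) = 0)
    (hz₃ : ∀ y, z (y, a.2) = 0) (hz₄ : ∀ y, z (y, b.2) = 0)
    {A ε : ℝ} (hε : 0 < ε)
    (hA : ∀ x ∈ Set.Icc a b, 1 ≤ A - Real.log (g₁ x ^ 2 + g₂ x ^ 2 + ε)) :
    ∫ x in Set.Icc a b, (z x * logLogDeriv g₁ g₂ A ε x) ^ 2 ≤
      ∫ x in Set.Icc a b, 4 * K ^ 2 * (fderiv ℝ z x (1, 0) ^ 2 + fderiv ℝ z x (0, 1) ^ 2) := by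
  obtain ⟨p₁, hp₁⟩ : ∃ f, f = fun x => fderiv ℝ g₁ x (1, 0) := ⟨_, rfl⟩
  obtain ⟨q₁, hq₁⟩ : ∃ f, f = fun x => fderiv ℝ g₁ x (0, 1) := ⟨_, rfl⟩
  obtain ⟨p₂, hp₂⟩ : ∃ f, f = fun x => fderiv ℝ g₂ x (1, 0) := ⟨_, rfl⟩
  obtain ⟨q₂, hq₂⟩ : ∃ f, f = fun x => fderiv ℝ g₂ x (0, 1) := ⟨_, rfl⟩
  obtain ⟨zu, hzu⟩ : ∃ f, f = fun x => fderiv ℝ z x (1, 0) := ⟨_, rfl⟩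
  obtain ⟨zv, hzv⟩ : ∃ f, f = fun x => fderiv ℝ z x (0, 1) := ⟨_, rfl⟩
  have cp₁ : Continuous p₁ := hp₁ ▸ continuous_fderiv_apply_const h₁ two_ne_zero _
  have cq₁ : Continuous q₁ := hq₁ ▸ continuous_fderiv_apply_const h₁ two_ne_zero _
  have cp₂ : Continuous p₂ := hp₂ ▸ continuous_fderiv_apply_const h₂ two_ne_zero _
  have cq₂ : Continuous q₂ := hq₂ ▸ continuous_fderiv_apply_const h₂ two_ne_zero _
  have czu : Continuous zu := hzu ▸ continuous_fderiv_apply_const hz one_ne_zero _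
  have czv : Continuous zv := hzv ▸ continuous_fderiv_apply_const hz one_ne_zero _
  have cz := hz.continuous
  have c₁ := h₁.continuous
  have c₂ := h₂.continuous
  have dp₁ : Differentiable ℝ p₁ := by
    rw [hp₁]
    exact ((h₁.fderiv_right (m := 1) (by norm_num)).clm_apply contDiff_const).differentiable
      (by norm_num)
  have dq₁ : Differentiable ℝ q₁ := by
    rw [hq₁]
    exact ((h₁.fderiv_right (m := 1) (by norm_num)).clm_apply contDiff_const).differentiable
      (by norm_num)
  have dp₂ : Differentiable ℝ p₂ := by
    rw [hp₂]
    exact ((h₂.fderiv_right (m := 1) (by norm_num)).clm_apply contDiff_const).differentiable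
      (by norm_num)
  have dq₂ : Differentiable ℝ q₂ := by
    rw [hq₂]
    exact ((h₂.fderiv_right (m := 1) (by norm_num)).clm_apply contDiff_const).differentiable
      (by norm_num)
  have comm₁ : ∀ x, fderiv ℝ p₁ x (0, 1) = fderiv ℝ q₁ x (1, 0) := fun x => by
    rw [hp₁, hq₁]; exact fderiv_apply_comm h₁ x _ _
  have comm₂ : ∀ x, fderiv ℝ p₂ x (0, 1) = fderiv ℝ q₂ x (1, 0) := fun x => by
    rw [hp₂, hq₂]; exact fderiv_apply_comm h₂ x _ _
  obtain ⟨s, hs⟩ : ∃ s : ℝ × ℝ → ℝ, s = fun x => g₁ x ^ 2 + g₂ x ^ 2 + ε := ⟨_, rfl⟩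
  have hs0 : ∀ x, s x ≠ 0 := fun x => by rw [hs]; positivity
  have ds : ∀ x, HasFDerivAt s ((2 * g₁ x) • fderiv ℝ g₁ x + (2 * g₂ x) • fderiv ℝ g₂ x) x := by
    intro x
    have e₁ := (h₁.differentiable two_ne_zero x).hasFDerivAt
    have e₂ := (h₂.differentiable two_ne_zero x).hasFDerivAt
    rw [hs]
    have key := ((e₁.pow 2).add (e₂.pow 2)).add_const ε
    simpa using key
  have cs : Continuous s := by rw [hs]; fun_prop
  obtain ⟨l, hl⟩ : ∃ l : ℝ × ℝ → ℝ, l = fun x => A - Real.log (s x) := ⟨_, rfl⟩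
  have cl : Continuous l := by rw [hl]; exact continuous_const.sub (cs.log hs0)
  have hl1 : ∀ x ∈ Set.Icc a b, 1 ≤ l x := fun x hx => by rw [hl, hs]; exact hA x hx
  have dl : ∀ x, HasFDerivAt l
      (-((s x)⁻¹ • ((2 * g₁ x) • fderiv ℝ g₁ x + (2 * g₂ x) • fderiv ℝ g₂ x))) x := by
    intro x
    rw [hl]
    exact ((ds x).log (hs0 x)).const_sub A
  obtain ⟨w, hw⟩ : ∃ w : ℝ × ℝ → ℝ, w = fun x => (s x * l x)⁻¹ := ⟨_, rfl⟩
  have dw : ∀ x ∈ Set.Icc a b, ∀ e, HasFDerivAt w (fderiv ℝ w x) x ∧ fderiv ℝ w x e =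
      -(l x - 1) / (s x * l x) ^ 2 * (2 * (g₁ x * fderiv ℝ g₁ x e + g₂ x * fderiv ℝ g₂ x e)) := by
    intro x hx e
    have hl0 : l x ≠ 0 := by linarith [hl1 x hx]
    have hm : HasFDerivAt (fun y => s y * l y) _ x := (ds x).mul (dl x)
    have hi : HasDerivAt (fun t : ℝ => t⁻¹) (-((s x * l x) ^ 2)⁻¹) (s x * l x) :=
      hasDerivAt_inv (mul_ne_zero (hs0 x) hl0)
    have hw' := hi.comp_hasFDerivAt x hm
    rw [show (fun t : ℝ => t⁻¹) ∘ (fun y => s y * l y) = w from hw.symm] at hw'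
    refine ⟨hw'.differentiableAt.hasFDerivAt, ?_⟩
    rw [hw'.fderiv]
    have := hs0 x
    simp
    field_simp
    ring
  obtain ⟨f, hf⟩ : ∃ f : ℝ × ℝ → ℝ, f = fun x => z x ^ 2 * w x * (g₁ x * q₂ x - g₂ x * q₁ x) :=
    ⟨_, rfl⟩
  obtain ⟨h, hh⟩ : ∃ h : ℝ × ℝ → ℝ, h = fun x => -(z x ^ 2 * w x * (g₁ x * p₂ x - g₂ x * p₁ x)) :=
    ⟨_, rfl⟩
  have dfh : ∀ x ∈ Set.Icc a b, HasFDerivAt f (fderiv ℝ f x) x ∧ HasFDerivAt h (fderiv ℝ h x) x ∧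
      fderiv ℝ f x (1, 0) + fderiv ℝ h x (0, 1) =
        (z x ^ 2 * (-(l x - 1) / (s x * l x) ^ 2 *
          (2 * (g₁ x * p₁ x + g₂ x * p₂ x) * (g₁ x * q₂ x - g₂ x * q₁ x)
            - 2 * (g₁ x * q₁ x + g₂ x * q₂ x) * (g₁ x * p₂ x - g₂ x * p₁ x)))
        + 2 * z x / (s x * l x) * (zu x * (g₁ x * q₂ x - g₂ x * q₁ x)
            - zv x * (g₁ x * p₂ x - g₂ x * p₁ x))
        + z x ^ 2 / (s x * l x) * (2 * (p₁ x * q₂ x - q₁ x * p₂ x))) := by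
    intro x hx
    have e₁ := (h₁.differentiable two_ne_zero x).hasFDerivAt
    have e₂ := (h₂.differentiable two_ne_zero x).hasFDerivAt
    have ez := (hz.differentiable one_ne_zero x).hasFDerivAt
    have ew := (dw x hx 0).1
    have hf' := ((ez.pow 2).mul ew).mul
      ((e₁.mul (dq₂ x).hasFDerivAt).sub (e₂.mul (dq₁ x).hasFDerivAt))
    have hh' := (((ez.pow 2).mul ew).mul
      ((e₁.mul (dp₂ x).hasFDerivAt).sub (e₂.mul (dp₁ x).hasFDerivAt))).neg
    rw [show (fun x => z x ^ 2) * w * (g₁ * q₂ - g₂ * q₁) = f from hf.symm] at hf'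
    rw [show -((fun x => z x ^ 2) * w * (g₁ * p₂ - g₂ * p₁)) = h from hh.symm] at hh'
    refine ⟨hf'.differentiableAt.hasFDerivAt, hh'.differentiableAt.hasFDerivAt, ?_⟩
    rw [hf'.fderiv, hh'.fderiv]
    have E₁ : fderiv ℝ g₁ x (1, 0) = p₁ x := by rw [hp₁]
    have E₂ : fderiv ℝ g₁ x (0, 1) = q₁ x := by rw [hq₁]
    have E₃ : fderiv ℝ g₂ x (1, 0) = p₂ x := by rw [hp₂]
    have E₄ : fderiv ℝ g₂ x (0, 1) = q₂ x := by rw [hq₂]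
    have E₅ : fderiv ℝ z x (1, 0) = zu x := by rw [hzu]
    have E₆ : fderiv ℝ z x (0, 1) = zv x := by rw [hzv]
    have E₇ : w x = (s x * l x)⁻¹ := by rw [hw]
    have E₈ := (dw x hx (1, 0)).2
    have E₉ := (dw x hx (0, 1)).2
    rw [E₁, E₃] at E₈
    rw [E₂, E₄] at E₉
    simp only [add_apply, sub_apply,
      neg_apply, smul_apply, smul_eq_mul,
      Pi.mul_apply, Pi.sub_apply, E₁, E₂, E₃, E₄, E₅, E₆, E₈, E₉, comm₁, comm₂]
    rw [E₇]
    simp only [Nat.add_one_sub_one, pow_one, nsmul_eq_mul, Nat.cast_ofNat]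
    ring
  have hDc : ContinuousOn (fun x => z x ^ 2 * (-(l x - 1) / (s x * l x) ^ 2 *
          (2 * (g₁ x * p₁ x + g₂ x * p₂ x) * (g₁ x * q₂ x - g₂ x * q₁ x)
            - 2 * (g₁ x * q₁ x + g₂ x * q₂ x) * (g₁ x * p₂ x - g₂ x * p₁ x)))
        + 2 * z x / (s x * l x) * (zu x * (g₁ x * q₂ x - g₂ x * q₁ x)
            - zv x * (g₁ x * p₂ x - g₂ x * p₁ x))
        + z x ^ 2 / (s x * l x) * (2 * (p₁ x * q₂ x - q₁ x * p₂ x))) (Set.Icc a b) := by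
    have hne : ∀ x ∈ Set.Icc a b, s x * l x ≠ 0 := fun x hx =>
      mul_ne_zero (hs0 x) (by linarith [hl1 x hx])
    have hne2 : ∀ x ∈ Set.Icc a b, (s x * l x) ^ 2 ≠ 0 := fun x hx => pow_ne_zero 2 (hne x hx)
    have k₁ : ContinuousOn (fun x => -(l x - 1) / (s x * l x) ^ 2) (Set.Icc a b) :=
      ContinuousOn.div (by fun_prop) (by fun_prop) hne2
    have k₂ : ContinuousOn (fun x => 2 * z x / (s x * l x)) (Set.Icc a b) :=
      ContinuousOn.div (by fun_prop) (by fun_prop) hne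
    have k₃ : ContinuousOn (fun x => z x ^ 2 / (s x * l x)) (Set.Icc a b) :=
      ContinuousOn.div (by fun_prop) (by fun_prop) hne
    fun_prop
  have hDi := hDc.integrableOn_compact (μ := MeasureTheory.volume) isCompact_Icc
  have hIoo : Set.Ioo a.1 b.1 ×ˢ Set.Ioo a.2 b.2 ⊆ Set.Icc a b := by
    rintro x ⟨hx1, hx2⟩
    exact ⟨⟨hx1.1.le, hx2.1.le⟩, ⟨hx1.2.le, hx2.2.le⟩⟩
  have hdivI := hDi.congr_fun (fun x hx => (dfh x hx).2.2.symm) measurableSet_Icc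
  have hdiv := MeasureTheory.integral_divergence_prod_Icc_of_hasFDerivAt_of_le f h
    (fderiv ℝ f) (fderiv ℝ h) a b hab
    (fun x hx => (dfh x hx).1.continuousAt.continuousWithinAt)
    (fun x hx => (dfh x hx).2.1.continuousAt.continuousWithinAt)
    (fun x hx => (dfh x (hIoo hx)).1) (fun x hx => (dfh x (hIoo hx)).2.1) hdivI
  have hzero : (((∫ x in a.1..b.1, h (x, b.2)) - ∫ x in a.1..b.1, h (x, a.2)) +
          ∫ y in a.2..b.2, f (b.1, y)) - ∫ y in a.2..b.2, f (a.1, y) = 0 := by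
    simp [hf, hh, hz₁, hz₂, hz₃, hz₄]
  rw [hzero] at hdiv
  have hgradI : MeasureTheory.IntegrableOn
      (fun x => 4 * K ^ 2 * (fderiv ℝ z x (1, 0) ^ 2 + fderiv ℝ z x (0, 1) ^ 2)) (Set.Icc a b) := by
    refine ContinuousOn.integrableOn_compact isCompact_Icc (Continuous.continuousOn ?_)
    have k₁ := czu
    have k₂ := czv
    rw [hzu] at k₁
    rw [hzv] at k₂
    fun_prop
  have hlhsI : MeasureTheory.IntegrableOn
      (fun x => (z x * logLogDeriv g₁ g₂ A ε x) ^ 2) (Set.Icc a b) :=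
    ((cz.continuousOn.mul (logLogDeriv_continuousOn h₁ h₂ hε hA)).pow 2).integrableOn_compact
      isCompact_Icc
  have hfinal : ∫ x in Set.Icc a b, (z x * logLogDeriv g₁ g₂ A ε x) ^ 2 ≤
      ∫ x in Set.Icc a b, (4 * K * (fderiv ℝ f x (1, 0) + fderiv ℝ h x (0, 1)) +
        4 * K ^ 2 * (fderiv ℝ z x (1, 0) ^ 2 + fderiv ℝ z x (0, 1) ^ 2)) := by
    refine MeasureTheory.setIntegral_mono_on hlhsI ((hdivI.const_mul (4 * K)).add hgradI)
      measurableSet_Icc fun x hx => ?_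
    rw [(dfh x hx).2.2]
    have hq := hqr x hx
    have key := caccioppoli_pointwise (z := z x) (zu := zu x) (zv := zv x) (l := l x)
      (g₁ := g₁ x) (g₂ := g₂ x) (s := s x) hK hε (hl1 x hx) (by rw [hs]) hq
    simp only [logLogDeriv]
    simp only [hl, hs, hp₁, hp₂, hq₁, hq₂, hzu, hzv] at key ⊢
    exact key
  rw [MeasureTheory.integral_add (hdivI.const_mul (4 * K)) hgradI,
    MeasureTheory.integral_const_mul, hdiv, mul_zero, zero_add] at hfinal
  exact hfinal

lemma logLogDeriv_hasDerivAt {g₁ g₂ : ℝ × ℝ → ℝ} (h₁ : ContDiff ℝ 2 g₁) (h₂ : ContDiff ℝ 2 g₂)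
    {A ε : ℝ} (hε : 0 < ε) {x y : ℝ}
    (hA : 1 ≤ A - Real.log (g₁ (x, y) ^ 2 + g₂ (x, y) ^ 2 + ε)) :
    HasDerivAt (fun t => -Real.log (A - Real.log (g₁ (t, y) ^ 2 + g₂ (t, y) ^ 2 + ε)))
      (logLogDeriv g₁ g₂ A ε (x, y)) x := by
  have hc : HasDerivAt (fun t : ℝ => (t, y)) ((1, 0) : ℝ × ℝ) x :=
    (hasDerivAt_id x).prodMk (hasDerivAt_const x y)
  have e₁ := (h₁.differentiable two_ne_zero (x, y)).hasFDerivAt.comp_hasDerivAt x hc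
  have e₂ := (h₂.differentiable two_ne_zero (x, y)).hasFDerivAt.comp_hasDerivAt x hc
  have hs : g₁ (x, y) ^ 2 + g₂ (x, y) ^ 2 + ε ≠ 0 := by positivity
  have hl : A - Real.log (g₁ (x, y) ^ 2 + g₂ (x, y) ^ 2 + ε) ≠ 0 := by linarith
  have key := (((((e₁.pow 2).add (e₂.pow 2)).add_const ε).log hs).const_sub A).log hl |>.neg
  refine key.congr_deriv ?_
  simp only [logLogDeriv, Function.comp]
  simp
  field_simp

/-- A quasiregular map of a rectangle vanishing along a vertical segment vanishes on the
horizontal lines through that segment. -/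
lemma quasiregular_eq_zero_horizontal {g₁ g₂ : ℝ × ℝ → ℝ}
    (h₁ : ContDiff ℝ 2 g₁) (h₂ : ContDiff ℝ 2 g₂) {K : ℝ} (hK : 0 < K) {a b : ℝ × ℝ}
    (hqr : ∀ x ∈ Set.Icc a b,
      fderiv ℝ g₁ x (1, 0) ^ 2 + fderiv ℝ g₁ x (0, 1) ^ 2
        + fderiv ℝ g₂ x (1, 0) ^ 2 + fderiv ℝ g₂ x (0, 1) ^ 2
      ≤ K * (fderiv ℝ g₁ x (1, 0) * fderiv ℝ g₂ x (0, 1)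
        - fderiv ℝ g₁ x (0, 1) * fderiv ℝ g₂ x (1, 0)))
    {p q v : ℝ} (hp : p ∈ Set.Ioo a.1 b.1) (hq : q ∈ Set.Ioo a.1 b.1) (hv : v ∈ Set.Ioo a.2 b.2)
    (h0 : ∀ᶠ y in nhds v, g₁ (p, y) = 0 ∧ g₂ (p, y) = 0) :
    g₁ (q, v) = 0 ∧ g₂ (q, v) = 0 := by
  by_contra hne
  have c₁ := h₁.continuous
  have c₂ := h₂.continuous
  have hr : 0 < g₁ (q, v) ^ 2 + g₂ (q, v) ^ 2 := by
    rcases not_and_or.mp hne with h | h <;> positivity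
  obtain ⟨r, hr0, hrlt⟩ := exists_between hr
  have hev : ∀ᶠ y in nhds v, r < g₁ (q, y) ^ 2 + g₂ (q, y) ^ 2 :=
    (Continuous.tendsto (f := fun y => g₁ (q, y) ^ 2 + g₂ (q, y) ^ 2) (by fun_prop) v).eventually
      (lt_mem_nhds hrlt)
  obtain ⟨δ, hδ, hball⟩ := Metric.nhds_basis_closedBall.eventually_iff.mp
    (h0.and (hev.and (Ioo_mem_nhds hv.1 hv.2)))
  rw [Real.closedBall_eq_Icc] at hball
  obtain ⟨M, hM⟩ := (isCompact_Icc (a := a) (b := b)).bddAbove_image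
    (f := fun x => g₁ x ^ 2 + g₂ x ^ 2) (by fun_prop)
  replace hM : ∀ x ∈ Set.Icc a b, g₁ x ^ 2 + g₂ x ^ 2 ≤ M := fun x hx =>
    hM (Set.mem_image_of_mem _ hx)
  obtain ⟨A, hAdef⟩ : ∃ A, A = 1 + Real.log (M + 1) := ⟨_, rfl⟩
  have hA : ∀ ε, 0 < ε → ε ≤ 1 → ∀ x ∈ Set.Icc a b,
      1 ≤ A - Real.log (g₁ x ^ 2 + g₂ x ^ 2 + ε) := by
    intro ε hε hε1 x hx
    have := Real.log_le_log (by positivity) (add_le_add (hM x hx) hε1)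
    rw [hAdef]
    linarith
  obtain ⟨I, hI⟩ : ∃ I : Set ℝ, I = Set.Icc (min p q) (max p q) := ⟨_, rfl⟩
  obtain ⟨V, hV⟩ : ∃ V : Set ℝ, V = Set.Icc (v - δ) (v + δ) := ⟨_, rfl⟩
  have hIsub : I ⊆ Set.Ioo a.1 b.1 := by
    intro x hx
    rw [hI] at hx
    exact ⟨lt_of_lt_of_le (lt_min hp.1 hq.1) hx.1, lt_of_le_of_lt hx.2 (max_lt hp.2 hq.2)⟩
  have hVsub : V ⊆ Set.Ioo a.2 b.2 := fun y hy => (hball (hV ▸ hy)).2.2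
  have hIVsub : I ×ˢ V ⊆ Set.Icc a b := by
    rintro x ⟨hx1, hx2⟩
    exact ⟨⟨(hIsub hx1).1.le, (hVsub hx2).1.le⟩, ⟨(hIsub hx1).2.le, (hVsub hx2).2.le⟩⟩
  have hIc : IsCompact I := hI ▸ isCompact_Icc
  have hVc : IsCompact V := hV ▸ isCompact_Icc
  have hIVc : IsCompact (I ×ˢ V) := hIc.prod hVc
  obtain ⟨z, hz⟩ : ∃ z : ℝ × ℝ → ℝ,
    z = fun x => (x.1 - a.1) * (b.1 - x.1) * ((x.2 - a.2) * (b.2 - x.2)) := ⟨_, rfl⟩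
  have hzc : ContDiff ℝ 1 z := by rw [hz]; fun_prop
  obtain ⟨κ, hκ, hκz⟩ : ∃ κ > 0, ∀ x ∈ I ×ˢ V, κ ≤ z x ^ 2 := by
    have hne : (I ×ˢ V).Nonempty := by
      refine ⟨(p, v), ?_, ?_⟩
      · rw [hI]; exact ⟨min_le_left _ _, le_max_left _ _⟩
      · rw [hV]; constructor <;> linarith
    obtain ⟨x₀, hx₀, hmin⟩ := hIVc.exists_isMinOn hne
      (f := fun x => z x ^ 2) (hzc.continuous.pow 2).continuousOn
    refine ⟨z x₀ ^ 2, ?_, fun x hx => hmin hx⟩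
    have h1 := hIsub hx₀.1
    have h2 := hVsub hx₀.2
    have : 0 < z x₀ := by
      rw [hz]
      exact mul_pos (mul_pos (sub_pos.2 h1.1) (sub_pos.2 h1.2))
        (mul_pos (sub_pos.2 h2.1) (sub_pos.2 h2.2))
    positivity
  obtain ⟨C, hC⟩ : ∃ C, C = ∫ x in Set.Icc a b,
    4 * K ^ 2 * (fderiv ℝ z x (1, 0) ^ 2 + fderiv ℝ z x (0, 1) ^ 2) := ⟨_, rfl⟩
  have hab : a ≤ b := ⟨(hp.1.trans hp.2).le, (hv.1.trans hv.2).le⟩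
  have henergy : ∀ ε, 0 < ε → ε ≤ 1 →
      ∫ x in I ×ˢ V, logLogDeriv g₁ g₂ A ε x ^ 2 ≤ C / κ := by
    intro ε hε hε1
    have hc := logLogDeriv_continuousOn h₁ h₂ hε (hA ε hε hε1)
    have hcac := caccioppoli_logLog h₁ h₂ hK hab hqr hzc (by simp [hz]) (by simp [hz])
      (by simp [hz]) (by simp [hz]) hε (hA ε hε hε1)
    rw [← hC] at hcac
    have hi : MeasureTheory.IntegrableOn
        (fun x => (z x * logLogDeriv g₁ g₂ A ε x) ^ 2) (Set.Icc a b) :=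
      ((hzc.continuous.continuousOn.mul hc).pow 2).integrableOn_compact isCompact_Icc
    have h3 : ∫ x in I ×ˢ V, κ * logLogDeriv g₁ g₂ A ε x ^ 2 ≤
        ∫ x in I ×ˢ V, (z x * logLogDeriv g₁ g₂ A ε x) ^ 2 := by
      refine MeasureTheory.setIntegral_mono_on ?_ (hi.mono_set hIVsub) hIVc.measurableSet ?_
      · exact (((hc.mono hIVsub).pow 2).integrableOn_compact hIVc).const_mul κ
      · intro x hx
        rw [mul_pow]
        exact mul_le_mul_of_nonneg_right (hκz x hx) (sq_nonneg _)
    have h4 : ∫ x in I ×ˢ V, (z x * logLogDeriv g₁ g₂ A ε x) ^ 2 ≤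
        ∫ x in Set.Icc a b, (z x * logLogDeriv g₁ g₂ A ε x) ^ 2 :=
      MeasureTheory.setIntegral_mono_set hi (Filter.Eventually.of_forall fun x => sq_nonneg _)
        hIVsub.eventuallyLE
    rw [MeasureTheory.integral_const_mul] at h3
    rw [le_div_iff₀ hκ]
    linarith
  have hgrowth : ∀ ε, 0 < ε → ε ≤ 1 → ∀ y ∈ V,
      Real.log (A - Real.log ε) - Real.log (A - Real.log r)
        ≤ ∫ x in I, (1 + logLogDeriv g₁ g₂ A ε (x, y) ^ 2) := by
    intro ε hε hε1 y hy
    obtain ⟨⟨hy1, hy2⟩, hy3, -⟩ := hball (hV ▸ hy)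
    have hmem : ∀ x ∈ I, (x, y) ∈ Set.Icc a b := fun x hx => hIVsub ⟨hx, hy⟩
    have hc : ContinuousOn (fun x => logLogDeriv g₁ g₂ A ε (x, y)) I :=
      (logLogDeriv_continuousOn h₁ h₂ hε (hA ε hε hε1)).comp (by fun_prop) hmem
    have hIu : I = Set.uIcc p q := hI
    have hftc := intervalIntegral.integral_eq_sub_of_hasDerivAt (a := p) (b := q)
      (fun x hx => logLogDeriv_hasDerivAt (y := y) h₁ h₂ hε
        (hA ε hε hε1 (x, y) (hmem x (hIu ▸ hx)))) ((hIu ▸ hc).intervalIntegrable)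
    have hqI : q ∈ I := by rw [hI]; exact ⟨min_le_right _ _, le_max_right _ _⟩
    have h5 := hA ε hε hε1 (q, y) (hmem q hqI)
    have h6 : Real.log (A - Real.log (g₁ (q, y) ^ 2 + g₂ (q, y) ^ 2 + ε)) ≤
        Real.log (A - Real.log r) := by
      refine Real.log_le_log (by linarith) ?_
      have := Real.log_le_log hr0 (show r ≤ g₁ (q, y) ^ 2 + g₂ (q, y) ^ 2 + ε by linarith)
      linarith
    have h7 : Real.log (A - Real.log ε) - Real.log (A - Real.log r) ≤
        ‖∫ x in p..q, logLogDeriv g₁ g₂ A ε (x, y)‖ := by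
      refine le_trans ?_ (Real.le_norm_self _)
      rw [hftc, hy1, hy2]
      simp only [ne_eq, OfNat.ofNat_ne_zero, not_false_eq_true, zero_pow, add_zero, zero_add]
      linarith
    refine h7.trans (intervalIntegral.norm_integral_le_integral_norm_uIoc.trans ?_)
    have hi2 : MeasureTheory.IntegrableOn
        (fun x => 1 + logLogDeriv g₁ g₂ A ε (x, y) ^ 2) I :=
      (continuousOn_const.add (hc.pow 2)).integrableOn_compact hIc
    have hsub : Set.uIoc p q ⊆ I := hIu ▸ Set.uIoc_subset_uIcc
    calc ∫ x in Set.uIoc p q, ‖logLogDeriv g₁ g₂ A ε (x, y)‖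
        ≤ ∫ x in Set.uIoc p q, (1 + logLogDeriv g₁ g₂ A ε (x, y) ^ 2) := by
          refine MeasureTheory.setIntegral_mono_on ?_ (hi2.mono_set hsub) measurableSet_uIoc ?_
          · exact (hc.norm.integrableOn_compact hIc).mono_set hsub
          · intro x _
            rw [Real.norm_eq_abs]
            have := sq_abs (logLogDeriv g₁ g₂ A ε (x, y))
            nlinarith [sq_nonneg (|logLogDeriv g₁ g₂ A ε (x, y)| - 1)]
      _ ≤ _ := MeasureTheory.setIntegral_mono_set hi2
          (Filter.Eventually.of_forall fun x => by positivity) hsub.eventuallyLE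
  obtain ⟨N, hN⟩ : ∃ N, N = MeasureTheory.volume.real (I ×ˢ V) + C / κ := ⟨_, rfl⟩
  have htotal : ∀ ε, 0 < ε → ε ≤ 1 →
      2 * δ * (Real.log (A - Real.log ε) - Real.log (A - Real.log r)) ≤ N := by
    intro ε hε hε1
    have hc : ContinuousOn (fun x => 1 + logLogDeriv g₁ g₂ A ε x ^ 2) (I ×ˢ V) :=
      continuousOn_const.add
        (((logLogDeriv_continuousOn h₁ h₂ hε (hA ε hε hε1)).mono hIVsub).pow 2)
    have hi := hc.integrableOn_compact (μ := MeasureTheory.volume) hIVc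
    have hi1 : MeasureTheory.IntegrableOn
        (fun x => logLogDeriv g₁ g₂ A ε x ^ 2) (I ×ˢ V) :=
      (((logLogDeriv_continuousOn h₁ h₂ hε (hA ε hε hε1)).mono hIVsub).pow 2).integrableOn_compact
        hIVc
    have hswap : ∫ x in I ×ˢ V, (1 + logLogDeriv g₁ g₂ A ε x ^ 2) =
        ∫ y in V, ∫ x in I, (1 + logLogDeriv g₁ g₂ A ε (x, y) ^ 2) := by
      have hi' := hi
      rw [MeasureTheory.Measure.volume_eq_prod] at hi' ⊢
      rw [MeasureTheory.IntegrableOn, ← MeasureTheory.Measure.prod_restrict] at hi'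
      rw [← MeasureTheory.Measure.prod_restrict, MeasureTheory.integral_prod_symm _ hi']
    have hiy : MeasureTheory.IntegrableOn
        (fun y => ∫ x in I, (1 + logLogDeriv g₁ g₂ A ε (x, y) ^ 2)) V := by
      have hi' := hi
      rw [MeasureTheory.Measure.volume_eq_prod, MeasureTheory.IntegrableOn,
        ← MeasureTheory.Measure.prod_restrict] at hi'
      exact hi'.integral_prod_right
    have hi0 : MeasureTheory.IntegrableOn (fun _ : ℝ × ℝ => (1 : ℝ)) (I ×ˢ V) :=
      continuousOn_const.integrableOn_compact hIVc
    have h8 := MeasureTheory.setIntegral_mono_on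
      (continuousOn_const.integrableOn_compact hVc) hiy hVc.measurableSet
      (hgrowth ε hε hε1)
    rw [← hswap, MeasureTheory.setIntegral_const, MeasureTheory.integral_add hi0 hi1,
      MeasureTheory.setIntegral_const, smul_eq_mul, smul_eq_mul, mul_one] at h8
    have h9 : MeasureTheory.volume.real V = 2 * δ := by
      rw [hV, Real.volume_real_Icc_of_le (by linarith)]; ring
    rw [h9] at h8
    rw [hN]
    linarith [henergy ε hε hε1]
  obtain ⟨T, hT⟩ : ∃ T, T = max A (N / (2 * δ) + Real.log (A - Real.log r) + 1) := ⟨_, rfl⟩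
  have hTA : A ≤ T := hT ▸ le_max_left _ _
  have hTN : N / (2 * δ) + Real.log (A - Real.log r) + 1 ≤ T := hT ▸ le_max_right _ _
  have hfin := htotal (Real.exp (A - Real.exp T)) (Real.exp_pos _)
    (Real.exp_le_one_iff.2 (by linarith [Real.add_one_le_exp T]))
  rw [Real.log_exp, sub_sub_cancel, Real.log_exp, mul_comm, ← le_div_iff₀ (by positivity)] at hfin
  linarith

/-- A quasiregular map of a rectangle vanishing along a horizontal segment vanishes on the
vertical lines through that segment. -/
lemma quasiregular_eq_zero_vertical {g₁ g₂ : ℝ × ℝ → ℝ}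
    (h₁ : ContDiff ℝ 2 g₁) (h₂ : ContDiff ℝ 2 g₂) {K : ℝ} (hK : 0 < K) {a b : ℝ × ℝ}
    (hqr : ∀ x ∈ Set.Icc a b,
      fderiv ℝ g₁ x (1, 0) ^ 2 + fderiv ℝ g₁ x (0, 1) ^ 2
        + fderiv ℝ g₂ x (1, 0) ^ 2 + fderiv ℝ g₂ x (0, 1) ^ 2
      ≤ K * (fderiv ℝ g₁ x (1, 0) * fderiv ℝ g₂ x (0, 1)
        - fderiv ℝ g₁ x (0, 1) * fderiv ℝ g₂ x (1, 0)))
    {p q u : ℝ} (hp : p ∈ Set.Ioo a.2 b.2) (hq : q ∈ Set.Ioo a.2 b.2) (hu : u ∈ Set.Ioo a.1 b.1)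
    (h0 : ∀ᶠ x in nhds u, g₁ (x, p) = 0 ∧ g₂ (x, p) = 0) :
    g₁ (u, q) = 0 ∧ g₂ (u, q) = 0 := by
  have hswap : ∀ {g : ℝ × ℝ → ℝ}, ContDiff ℝ 2 g → ∀ x d,
      fderiv ℝ (g ∘ Prod.swap) x d = fderiv ℝ g x.swap d.swap := by
    intro g hg x d
    have hs : HasFDerivAt (Prod.swap : ℝ × ℝ → ℝ × ℝ)
        (ContinuousLinearEquiv.prodComm ℝ ℝ ℝ : ℝ × ℝ →L[ℝ] ℝ × ℝ) x :=
      (ContinuousLinearEquiv.prodComm ℝ ℝ ℝ).hasFDerivAt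
    rw [((hg.differentiable two_ne_zero x.swap).hasFDerivAt.comp x hs).fderiv]
    rfl
  have hcs : ContDiff ℝ 2 (Prod.swap : ℝ × ℝ → ℝ × ℝ) := contDiff_snd.prodMk contDiff_fst
  have key := quasiregular_eq_zero_horizontal (g₁ := g₂ ∘ Prod.swap) (g₂ := g₁ ∘ Prod.swap)
    (h₂.comp hcs) (h₁.comp hcs) hK (a := a.swap) (b := b.swap)
    (fun x hx => by
      have := hqr x.swap ⟨⟨hx.1.2, hx.1.1⟩, ⟨hx.2.2, hx.2.1⟩⟩
      simp only [hswap h₁, hswap h₂, Prod.swap_prod_mk]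
      linarith) hp hq hu (h0.mono fun x hx => hx.symm)
  exact key.symm

/-- Weak unique continuation for quasiregular maps of a rectangle. -/
lemma quasiregular_eq_zero {g₁ g₂ : ℝ × ℝ → ℝ}
    (h₁ : ContDiff ℝ 2 g₁) (h₂ : ContDiff ℝ 2 g₂) {K : ℝ} (hK : 0 < K) {a b : ℝ × ℝ}
    (hqr : ∀ x ∈ Set.Icc a b,
      fderiv ℝ g₁ x (1, 0) ^ 2 + fderiv ℝ g₁ x (0, 1) ^ 2
        + fderiv ℝ g₂ x (1, 0) ^ 2 + fderiv ℝ g₂ x (0, 1) ^ 2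
      ≤ K * (fderiv ℝ g₁ x (1, 0) * fderiv ℝ g₂ x (0, 1)
        - fderiv ℝ g₁ x (0, 1) * fderiv ℝ g₂ x (1, 0)))
    {p x : ℝ × ℝ} (hp : p ∈ Set.Ioo a.1 b.1 ×ˢ Set.Ioo a.2 b.2)
    (hx : x ∈ Set.Ioo a.1 b.1 ×ˢ Set.Ioo a.2 b.2)
    (h0 : ∀ᶠ y in nhds p, g₁ y = 0 ∧ g₂ y = 0) :
    g₁ x = 0 ∧ g₂ x = 0 := by
  have h0' : ∀ᶠ y in nhds p.2, g₁ (p.1, y) = 0 ∧ g₂ (p.1, y) = 0 :=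
    (Continuous.tendsto (f := fun y : ℝ => (p.1, y)) (by fun_prop) p.2).eventually h0
  have hstrip : ∀ u ∈ Set.Ioo a.1 b.1, g₁ (u, p.2) = 0 ∧ g₂ (u, p.2) = 0 := fun u hu =>
    quasiregular_eq_zero_horizontal h₁ h₂ hK hqr hp.1 hu hp.2 h0'
  exact quasiregular_eq_zero_vertical h₁ h₂ hK hqr hp.2 hx.2 hx.1
    (Filter.eventually_of_mem (Ioo_mem_nhds hx.1.1 hx.1.2) hstrip)

lemma mink_comm (n : ℕ) (a b : MV n) : mink n a b = mink n b a := by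
  simp only [mink, mul_comm]

lemma mink_add_right (n : ℕ) (a b c : MV n) : mink n a (b + c) = mink n a b + mink n a c := by
  rw [mink_comm, mink_add_left, mink_comm n b, mink_comm n c]

lemma mink_smul_right (n : ℕ) (r : ℝ) (a c : MV n) : mink n a (r • c) = r * mink n a c := by
  rw [mink_comm, mink_smul_left, mink_comm]

lemma mink_neg_left (n : ℕ) (a c : MV n) : mink n (-a) c = -mink n a c := by
  rw [← neg_one_smul ℝ, mink_smul_left, neg_one_mul]

lemma mink_sub_left (n : ℕ) (a b c : MV n) : mink n (a - b) c = mink n a c - mink n b c := by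
  rw [sub_eq_add_neg, mink_add_left, mink_neg_left, sub_eq_add_neg]

lemma mink_sub_right (n : ℕ) (a b c : MV n) : mink n a (b - c) = mink n a b - mink n a c := by
  rw [mink_comm, mink_sub_left, mink_comm n b, mink_comm n c]

lemma mink_zero_right (n : ℕ) (a : MV n) : mink n a 0 = 0 := by
  rw [mink_comm, mink_zero_left]

/-- The Minkowski form as a continuous bilinear map. -/
def minkL (n : ℕ) : MV n →L[ℝ] MV n →L[ℝ] ℝ :=
  (LinearMap.mk₂ ℝ (mink n) (mink_add_left n) (mink_smul_left n) (mink_add_right n)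
    (mink_smul_right n)).toContinuousBilinearMap

lemma minkL_apply (n : ℕ) (a b : MV n) : minkL n a b = mink n a b := rfl

lemma ContDiff.mink {n : ℕ} {k : WithTop ℕ∞} {f g : Surf → MV n} (hf : ContDiff ℝ k f)
    (hg : ContDiff ℝ k g) : ContDiff ℝ k fun x => mink n (f x) (g x) :=
  ((minkL n).contDiff.comp hf).clm_apply hg

lemma ContDiff.wedge {n : ℕ} {k : WithTop ℕ∞} {f g h : Surf → MV n} (hf : ContDiff ℝ k f)
    (hg : ContDiff ℝ k g) (hh : ContDiff ℝ k h) :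
    ContDiff ℝ k fun x => wedge n (f x) (g x) (h x) :=
  ((hf.mink hh).smul hg).sub ((hg.mink hh).smul hf)

lemma fderiv_mink {n : ℕ} {f g : Surf → MV n} {x : Surf} (hf : DifferentiableAt ℝ f x)
    (hg : DifferentiableAt ℝ g x) (e : Surf) :
    fderiv ℝ (fun y => mink n (f y) (g y)) x e
      = mink n (fderiv ℝ f x e) (g x) + mink n (f x) (fderiv ℝ g x e) := by
  have h := (minkL n).hasFDerivAt_of_bilinear hf.hasFDerivAt hg.hasFDerivAt
  simp only [minkL_apply] at h
  rw [h.fderiv, add_comm]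
  rfl

lemma fderiv_mink_const {n : ℕ} {f : Surf → MV n} {x : Surf} (hf : DifferentiableAt ℝ f x)
    (z : MV n) (e : Surf) :
    fderiv ℝ (fun y => mink n (f y) z) x e = mink n (fderiv ℝ f x e) z := by
  rw [fderiv_mink hf (differentiableAt_const z)]
  simp [mink_zero_right]

lemma fderiv_wedge_const {n : ℕ} {f g : Surf → MV n} {x : Surf} (hf : DifferentiableAt ℝ f x)
    (hg : DifferentiableAt ℝ g x) (z : MV n) (e : Surf) :
    fderiv ℝ (fun y => wedge n (f y) (g y) z) x e
      = wedge n (fderiv ℝ f x e) (g x) z + wedge n (f x) (fderiv ℝ g x e) z := by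
  have hf' : DifferentiableAt ℝ (fun y => mink n (f y) z) x :=
    ((minkL n).flip z).differentiableAt.comp x hf
  have hg' : DifferentiableAt ℝ (fun y => mink n (g y) z) x :=
    ((minkL n).flip z).differentiableAt.comp x hg
  unfold wedge
  rw [fderiv_fun_sub (hf'.fun_smul hg) (hg'.fun_smul hf), fderiv_fun_smul hf' hg, fderiv_fun_smul hg' hf]
  simp only [sub_apply, add_apply, smul_apply, ContinuousLinearMap.smulRight_apply,
    fderiv_mink_const hf, fderiv_mink_const hg]
  abel

/-- The orthogonal complement of a null line is positive semidefinite with that line as radical. -/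
lemma mink_self_of_perp_null {n : ℕ} {F y : MV n} (hF : F ≠ 0) (hn : mink n F F = 0)
    (h : mink n F y = 0) : 0 ≤ mink n y y ∧ (mink n y y = 0 → ∃ c : ℝ, y = c • F) := by
  have hl : F (Fin.last (n + 1)) ≠ 0 := by
    intro h0
    apply hF
    simp only [mink, h0, mul_zero, sub_zero] at hn
    rw [Finset.sum_eq_zero_iff_of_nonneg fun i _ => mul_self_nonneg _] at hn
    ext i
    refine Fin.lastCases h0 (fun j => ?_) i
    simpa using hn j (Finset.mem_univ j)
  obtain ⟨c, hc⟩ : ∃ c, c = y (Fin.last (n + 1)) / F (Fin.last (n + 1)) := ⟨_, rfl⟩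
  have hcl : (y - c • F) (Fin.last (n + 1)) = 0 := by
    simp [hc, div_mul_cancel₀ _ hl]
  have hsum : mink n y y = ∑ i : Fin (n + 1),
      (y - c • F) i.castSucc * (y - c • F) i.castSucc := by
    have h1 : mink n (y - c • F) (y - c • F) = mink n y y := by
      simp only [mink_sub_left, mink_sub_right, mink_smul_left, mink_smul_right, hn, h,
        mink_comm n y F]
      ring
    rw [← h1, mink, hcl, mul_zero, sub_zero]
  refine ⟨hsum ▸ Finset.sum_nonneg fun i _ => mul_self_nonneg _, fun h0 => ⟨c, ?_⟩⟩
  rw [hsum, Finset.sum_eq_zero_iff_of_nonneg fun i _ => mul_self_nonneg _] at h0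
  rw [← sub_eq_zero]
  ext i
  refine Fin.lastCases hcl (fun j => ?_) i
  exact mul_self_eq_zero.mp (h0 j (Finset.mem_univ j))

lemma gram_pos {n : ℕ} {F A B : MV n} (hn : mink n F F = 0) (hA : mink n F A = 0)
    (hB : mink n F B = 0) (hli : LinearIndependent ℝ ![F, A, B]) :
    0 < mink n A A ∧ 0 < mink n A A * mink n B B - mink n A B ^ 2 := by
  have hF : F ≠ 0 := hli.ne_zero 0
  have hpos : ∀ α β : ℝ, (α ≠ 0 ∨ β ≠ 0) → 0 < mink n (α • A + β • B) (α • A + β • B) := by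
    intro α β hαβ
    obtain ⟨h1, h2⟩ := mink_self_of_perp_null (y := α • A + β • B) hF hn
      (by simp [mink_add_right, mink_smul_right, hA, hB])
    refine lt_of_le_of_ne h1 fun h0 => ?_
    obtain ⟨c, hc⟩ := h2 h0.symm
    rw [Fintype.linearIndependent_iff] at hli
    have h3 := hli ![-c, α, β] (by
      simp only [Fin.sum_univ_three, Matrix.cons_val_zero, Matrix.cons_val_one, Matrix.cons_val]
      rw [add_assoc, hc, neg_smul, neg_add_cancel])
    rcases hαβ with h | h
    · exact h (h3 1)
    · exact h (h3 2)
  have hE : 0 < mink n A A := by simpa using hpos 1 0 (by simp)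
  refine ⟨hE, ?_⟩
  have h4 := hpos (-mink n A B) (mink n A A) (Or.inr hE.ne')
  simp only [mink_add_left, mink_add_right, mink_smul_left, mink_smul_right, mink_comm n B A] at h4
  have h5 : 0 < mink n A A * (mink n A A * mink n B B - mink n A B ^ 2) := by linarith
  exact pos_of_mul_pos_right h5 hE.le

/-- The pointwise algebraic form of a closed `Λ ∧ Λ^⊥`-valued 1-form: `η` takes values in
`Λ ∧ Λ^{(1)}` and is trace-free and symmetric. -/
lemma exists_coeff_of_closed {n : ℕ} {F A B W₁ W₂ P₁ P₂ : MV n} (hn : mink n F F = 0)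
    (hA : mink n F A = 0) (hB : mink n F B = 0) (hli : LinearIndependent ℝ ![F, A, B])
    (hW₁ : mink n F W₁ = 0) (hW₂ : mink n F W₂ = 0)
    (hcl : ∀ z, wedge n A W₂ z + wedge n F P₂ z = wedge n B W₁ z + wedge n F P₁ z)
    (hP₁ : mink n B W₁ + mink n F P₁ = 0) (hP₂ : mink n A W₂ + mink n F P₂ = 0) :
    ∃ a c d f₁ f₂ : ℝ, W₁ = c • A + d • B + f₁ • F ∧ W₂ = a • A - c • B + f₂ • F ∧
      a * mink n A A = 2 * c * mink n A B + d * mink n B B := by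
  have hF : F ≠ 0 := hli.ne_zero 0
  obtain ⟨hE, hΔ⟩ := gram_pos hn hA hB hli
  have hsymm : mink n A W₂ = mink n B W₁ := by
    have h := hcl F
    simp only [wedge, hn, mink_comm n A F, hA, mink_comm n B F, hB, mink_comm n W₁ F, hW₁,
      mink_comm n W₂ F, hW₂, mink_comm n P₁ F, mink_comm n P₂ F, zero_smul, sub_zero, zero_sub,
      zero_add, neg_inj] at h
    have := smul_left_injective ℝ hF h
    linarith
  have hstar : ∀ z y, mink n F z = 0 → mink n F y = 0 →
      mink n A z * mink n W₂ y - mink n W₂ z * mink n A y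
        = mink n B z * mink n W₁ y - mink n W₁ z * mink n B y := by
    intro z y hz hy
    have h := congrArg (fun v => mink n v y) (hcl z)
    simpa only [wedge, mink_add_left, mink_sub_left, mink_smul_left, hz, hy, mul_zero, zero_mul,
      sub_zero, add_zero] using h
  have hnormal : ∀ z, mink n F z = 0 → mink n A z = 0 → mink n B z = 0 →
      mink n W₁ z = 0 ∧ mink n W₂ z = 0 := by
    intro z h1 h2 h3
    have h4 := hstar z A h1 hA
    have h5 := hstar z B h1 hB
    rw [h2, h3] at h4 h5
    rw [mink_comm n B A] at h4
    constructor
    · refine (mul_eq_zero.mp (?_ : (mink n A A * mink n B B - mink n A B ^ 2) * _ = 0)).resolve_left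
        hΔ.ne'
      linear_combination -mink n A B * h4 + mink n A A * h5
    · refine (mul_eq_zero.mp (?_ : (mink n A A * mink n B B - mink n A B ^ 2) * _ = 0)).resolve_left
        hΔ.ne'
      linear_combination -mink n B B * h4 + mink n A B * h5
  have hdecomp : ∀ W, mink n F W = 0 →
      (∀ z, mink n F z = 0 → mink n A z = 0 → mink n B z = 0 → mink n W z = 0) →
      ∃ α β f : ℝ, W = α • A + β • B + f • F := by
    intro W hW hz
    obtain ⟨Δ, hΔe⟩ : ∃ Δ, Δ = mink n A A * mink n B B - mink n A B ^ 2 := ⟨_, rfl⟩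
    have hΔ0 : Δ ≠ 0 := hΔe ▸ hΔ.ne'
    obtain ⟨α, hα⟩ : ∃ α, α = (mink n B B * mink n A W - mink n A B * mink n B W) / Δ := ⟨_, rfl⟩
    obtain ⟨β, hβ⟩ : ∃ β, β = (mink n A A * mink n B W - mink n A B * mink n A W) / Δ := ⟨_, rfl⟩
    have e1 : mink n F (W - (α • A + β • B)) = 0 := by
      simp [mink_sub_right, mink_add_right, mink_smul_right, hA, hB, hW]
    have e2 : mink n A (W - (α • A + β • B)) = 0 := by
      simp only [mink_sub_right, mink_add_right, mink_smul_right, hα, hβ]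
      field_simp
      rw [hΔe]; ring
    have e3 : mink n B (W - (α • A + β • B)) = 0 := by
      simp only [mink_sub_right, mink_add_right, mink_smul_right, hα, hβ, mink_comm n B A]
      field_simp
      rw [hΔe]; ring
    have e4 : mink n (W - (α • A + β • B)) (W - (α • A + β • B)) = 0 := by
      rw [mink_sub_left, mink_add_left, mink_smul_left, mink_smul_left, e2, e3, hz _ e1 e2 e3]
      ring
    obtain ⟨f, hf⟩ := (mink_self_of_perp_null hF hn e1).2 e4
    exact ⟨α, β, f, by rw [← hf]; abel⟩
  obtain ⟨c, d, f₁, h₁⟩ := hdecomp W₁ hW₁ fun z a b c => (hnormal z a b c).1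
  obtain ⟨a, b, f₂, h₂⟩ := hdecomp W₂ hW₂ fun z a b c => (hnormal z a b c).2
  have hAF : mink n A F = 0 := by rw [mink_comm, hA]
  have hBF : mink n B F = 0 := by rw [mink_comm, hB]
  have h6 := hstar A B hA hB
  rw [h₁, h₂] at hsymm h6
  simp only [mink_add_left, mink_add_right, mink_smul_left, mink_smul_right, mink_comm n B A,
    hA, hB, hAF, hBF] at hsymm h6
  have hb : b = -c := by
    have : (mink n A A * mink n B B - mink n A B ^ 2) * (b + c) = 0 := by linear_combination h6
    linarith [(mul_eq_zero.mp this).resolve_left hΔ.ne']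
  refine ⟨a, c, d, f₁, f₂, h₁, by rw [h₂, hb, neg_smul, sub_eq_add_neg], ?_⟩
  rw [hb] at hsymm
  linear_combination hsymm

/-- The quasiregularity estimate for the components of a trace-free symmetric 1-form. -/
lemma quasiregular_estimate {E M G a c d m₁₁ m₁₂ m₂₁ m₂₂ : ℝ} (hE : 0 < E)
    (hΔ : 0 < E * G - M ^ 2) (ha : a * E = 2 * c * M + d * G)
    (hm : 0 < m₁₂ * m₂₁ - m₁₁ * m₂₂) {J : ℝ}
    (hJ : J = (c * m₁₁ + d * m₂₁) * (a * m₁₂ - c * m₂₂)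
      - (a * m₁₁ - c * m₂₁) * (c * m₁₂ + d * m₂₂)) :
    0 ≤ J ∧ (J = 0 → a = 0 ∧ c = 0 ∧ d = 0) ∧
    (c * m₁₁ + d * m₂₁) ^ 2 + (a * m₁₁ - c * m₂₁) ^ 2
        + (c * m₁₂ + d * m₂₂) ^ 2 + (a * m₁₂ - c * m₂₂) ^ 2 ≤
      (2 + (4 * M ^ 2 + G ^ 2) / E ^ 2) * (m₁₁ ^ 2 + m₁₂ ^ 2 + m₂₁ ^ 2 + m₂₂ ^ 2) *
        ((E + G) * E / ((E * G - M ^ 2) * (m₁₂ * m₂₁ - m₁₁ * m₂₂))) * J := by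
  obtain ⟨Δ, hΔe⟩ : ∃ Δ, Δ = E * G - M ^ 2 := ⟨_, rfl⟩
  obtain ⟨μ, hμ⟩ : ∃ μ, μ = m₁₂ * m₂₁ - m₁₁ * m₂₂ := ⟨_, rfl⟩
  rw [← hΔe] at hΔ ⊢
  rw [← hμ] at hm ⊢
  have hG : 0 < G := by
    have : 0 < E * G := by rw [hΔe] at hΔ; nlinarith [sq_nonneg M]
    exact pos_of_mul_pos_right this hE.le
  have hJ' : E * J = μ * (E * c ^ 2 + 2 * M * c * d + G * d ^ 2) := by
    rw [hJ, hμ]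
    linear_combination (m₁₂ * m₂₁ - m₁₁ * m₂₂) * d * ha
  have h1 : c ^ 2 + d ^ 2 ≤ (E + G) * E / (Δ * μ) * J := by
    rw [div_mul_eq_mul_div, le_div_iff₀ (by positivity), mul_assoc (E + G), hJ']
    have : Δ * (c ^ 2 + d ^ 2) ≤ (E + G) * (E * c ^ 2 + 2 * M * c * d + G * d ^ 2) := by
      rw [hΔe]
      nlinarith [sq_nonneg (E * c + M * d), sq_nonneg (M * c + G * d)]
    nlinarith [mul_le_mul_of_nonneg_left this hm.le]
  have hJ0 : 0 ≤ J := by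
    refine nonneg_of_mul_nonneg_right (le_trans ?_ h1) (by positivity)
    positivity
  refine ⟨hJ0, fun h0 => ?_, ?_⟩
  · rw [h0, mul_zero] at h1
    have hc : c = 0 := by nlinarith [sq_nonneg c, sq_nonneg d]
    have hd : d = 0 := by nlinarith [sq_nonneg c, sq_nonneg d]
    rw [hc, hd, mul_zero, zero_mul, zero_mul, add_zero] at ha
    exact ⟨(mul_eq_zero.mp ha).resolve_right hE.ne', hc, hd⟩
  have h2 : a ^ 2 ≤ (4 * M ^ 2 + G ^ 2) / E ^ 2 * (c ^ 2 + d ^ 2) := by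
    rw [div_mul_eq_mul_div, le_div_iff₀ (by positivity), ← mul_pow, ha]
    nlinarith [sq_nonneg (2 * M * d - G * c)]
  obtain ⟨k, hk⟩ : ∃ k, k = (4 * M ^ 2 + G ^ 2) / E ^ 2 := ⟨_, rfl⟩
  rw [← hk] at h2 ⊢
  have hk0 : 0 ≤ k := by rw [hk]; positivity
  have h3 : ∀ p q x y : ℝ, (p * x + q * y) ^ 2 ≤ (p ^ 2 + q ^ 2) * (x ^ 2 + y ^ 2) := by
    intro p q x y
    nlinarith [sq_nonneg (p * y - q * x)]
  have e1 := h3 c d m₁₁ m₂₁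
  have e2 := h3 c d m₁₂ m₂₂
  have e3 := h3 a (-c) m₁₁ m₂₁
  have e4 := h3 a (-c) m₁₂ m₂₂
  calc _ ≤ (2 * (c ^ 2 + d ^ 2) + a ^ 2) * (m₁₁ ^ 2 + m₁₂ ^ 2 + m₂₁ ^ 2 + m₂₂ ^ 2) := by
        nlinarith [mul_nonneg (sq_nonneg d)
          (by positivity : 0 ≤ m₁₁ ^ 2 + m₁₂ ^ 2 + m₂₁ ^ 2 + m₂₂ ^ 2)]
    _ ≤ ((2 + k) * (c ^ 2 + d ^ 2)) * (m₁₁ ^ 2 + m₁₂ ^ 2 + m₂₁ ^ 2 + m₂₂ ^ 2) :=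
        mul_le_mul_of_nonneg_right (by linarith) (by positivity)
    _ = (2 + k) * (m₁₁ ^ 2 + m₁₂ ^ 2 + m₂₁ ^ 2 + m₂₂ ^ 2) * (c ^ 2 + d ^ 2) := by ring
    _ ≤ (2 + k) * (m₁₁ ^ 2 + m₁₂ ^ 2 + m₂₁ ^ 2 + m₂₂ ^ 2) * ((E + G) * E / (Δ * μ) * J) :=
        mul_le_mul_of_nonneg_left h1 (by positivity)
    _ = _ := by ring

/-- The Poincaré lemma in the plane. -/
lemma exists_primitive {P Q : ℝ × ℝ → ℝ} (hP : ContDiff ℝ 1 P) (hQ : ContDiff ℝ 1 Q)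
    (hcl : ∀ x, fderiv ℝ P x (0, 1) = fderiv ℝ Q x (1, 0)) :
    ∃ g : ℝ × ℝ → ℝ, ContDiff ℝ 2 g ∧
      ∀ x, fderiv ℝ g x (1, 0) = P x ∧ fderiv ℝ g x (0, 1) = Q x := by
  obtain ⟨ω, hω⟩ : ∃ ω : ℝ × ℝ → (ℝ × ℝ →L[ℝ] ℝ), ω = fun x =>
    P x • ContinuousLinearMap.fst ℝ ℝ ℝ + Q x • ContinuousLinearMap.snd ℝ ℝ ℝ := ⟨_, rfl⟩
  have hωc : ContDiff ℝ 1 ω := by rw [hω]; fun_prop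
  have hdP := hP.differentiable one_ne_zero
  have hdQ := hQ.differentiable one_ne_zero
  have hd : ∀ a x y, fderiv ℝ ω a x y = fderiv ℝ P a x * y.1 + fderiv ℝ Q a x * y.2 := by
    intro a x y
    rw [hω, fderiv_fun_add ((hdP a).smul_const (ContinuousLinearMap.fst ℝ ℝ ℝ))
      ((hdQ a).smul_const (ContinuousLinearMap.snd ℝ ℝ ℝ)),
      fderiv_smul_const (hdP a), fderiv_smul_const (hdQ a)]
    simp
  have hsplit : ∀ (L : ℝ × ℝ →L[ℝ] ℝ) (x : ℝ × ℝ), L x = x.1 * L (1, 0) + x.2 * L (0, 1) := by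
    intro L x
    conv_lhs => rw [show x = x.1 • ((1, 0) : ℝ × ℝ) + x.2 • ((0, 1) : ℝ × ℝ) by ext <;> simp]
    rw [map_add, map_smul, map_smul, smul_eq_mul, smul_eq_mul]
  obtain ⟨g, hg⟩ := convex_univ.exists_forall_hasFDerivAt_of_fderiv_symmetric isOpen_univ
    (hωc.differentiable one_ne_zero).differentiableOn (fun a _ x y => by
      rw [hd, hd, hsplit (fderiv ℝ P a) x, hsplit (fderiv ℝ Q a) x, hsplit (fderiv ℝ P a) y,
        hsplit (fderiv ℝ Q a) y, hcl]
      ring)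
  have hfd : fderiv ℝ g = ω := funext fun x => (hg x trivial).fderiv
  refine ⟨g, ?_, fun x => ?_⟩
  · rw [show (2 : WithTop ℕ∞) = 1 + 1 by norm_num, contDiff_succ_iff_fderiv]
    exact ⟨fun x => (hg x trivial).differentiableAt, by simp, hfd ▸ hωc⟩
  · rw [hfd, hω]
    simp

lemma exists_mink_ne_zero {n : ℕ} {v : MV n} (hv : v ≠ 0) : ∃ z, mink n v z ≠ 0 := by
  by_contra! h
  apply hv
  ext i
  refine Fin.lastCases ?_ (fun j => ?_) i
  · simpa [mink, Fin.castSucc_ne_last] using h (EuclideanSpace.single (Fin.last (n + 1)) 1)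
  · simpa [mink, Pi.single_apply, (Fin.castSucc_ne_last j).symm] using
      h (EuclideanSpace.single j.castSucc 1)

lemma wedge_of_eq_combination {n : ℕ} {F A B W : MV n} {α β f : ℝ}
    (hW : W = α • A + β • B + f • F) (z : MV n) :
    wedge n F W z = α • wedge n F A z + β • wedge n F B z := by
  simp only [hW, wedge, mink_add_left, mink_smul_left]
  module

lemma fderiv_eq_zero_of_partials {E : Type*} [NormedAddCommGroup E] [NormedSpace ℝ E]
    {f : ℝ × ℝ → E} {x : ℝ × ℝ} (h₁ : fderiv ℝ f x (1, 0) = 0) (h₂ : fderiv ℝ f x (0, 1) = 0) :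
    fderiv ℝ f x = 0 := by
  ext
  · simpa using h₁
  · simpa using h₂

namespace IsothermicSurface

variable {n : ℕ} (S : IsothermicSurface n)

lemma differentiable_F : Differentiable ℝ S.F := S.smooth_F.differentiable (by simp)

lemma differentiable_W₁ : Differentiable ℝ S.W₁ := S.smooth_W₁.differentiable (by simp)

lemma differentiable_W₂ : Differentiable ℝ S.W₂ := S.smooth_W₂.differentiable (by simp)

lemma contDiff_pd (e : Surf) : ContDiff ℝ 1 (pd e S.F) :=
  ((S.smooth_F.of_le (by norm_cast)).fderiv_right (m := 1) le_rfl).clm_apply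
    contDiff_const

lemma mink_pd (x e : Surf) : mink n (S.F x) (pd e S.F x) = 0 := by
  have h := fderiv_mink (S.differentiable_F x) (S.differentiable_F x) e
  rw [show (fun y => mink n (S.F y) (S.F y)) = fun _ => (0 : ℝ) from funext S.F_null] at h
  simp only [fderiv_fun_const, Pi.zero_apply, zero_apply] at h
  rw [mink_comm n _ (S.F x)] at h
  unfold pd
  linarith

lemma closed_expanded (x : Surf) (z : MV n) :
    wedge n (pd du S.F x) (S.W₂ x) z + wedge n (S.F x) (fderiv ℝ S.W₂ x du) z
      = wedge n (pd dv S.F x) (S.W₁ x) z + wedge n (S.F x) (fderiv ℝ S.W₁ x dv) z := by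
  have h := S.eta_closed x z
  rwa [fderiv_wedge_const (S.differentiable_F x) (S.differentiable_W₂ x),
    fderiv_wedge_const (S.differentiable_F x) (S.differentiable_W₁ x)] at h

lemma exists_coeff (x : Surf) :
    ∃ a c d f₁ f₂ : ℝ, S.W₁ x = c • pd du S.F x + d • pd dv S.F x + f₁ • S.F x ∧
      S.W₂ x = a • pd du S.F x - c • pd dv S.F x + f₂ • S.F x ∧
      a * gUU n S.F x = 2 * c * gUV n S.F x + d * gVV n S.F x := by
  have hP : ∀ {W : Surf → MV n}, Differentiable ℝ W → (∀ y, mink n (S.F y) (W y) = 0) → ∀ e,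
      mink n (pd e S.F x) (W x) + mink n (S.F x) (fderiv ℝ W x e) = 0 := by
    intro W hW h0 e
    have h := fderiv_mink (S.differentiable_F x) (hW x) e
    rw [show (fun y => mink n (S.F y) (W y)) = fun _ => (0 : ℝ) from funext h0] at h
    simpa [pd] using h.symm
  exact exists_coeff_of_closed (S.F_null x) (S.mink_pd x du) (S.mink_pd x dv) (S.immersed x)
    (S.W₁_perp x) (S.W₂_perp x) (S.closed_expanded x) (hP S.differentiable_W₁ S.W₁_perp dv)
    (hP S.differentiable_W₂ S.W₂_perp du)

/-- The zero set of the 1-form `η`. -/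
def etaZero : Set Surf :=
  {x | ∀ z, wedge n (S.F x) (S.W₁ x) z = 0 ∧ wedge n (S.F x) (S.W₂ x) z = 0}

lemma exists_eta_primitive (z y : MV n) : ∃ g : Surf → ℝ, ContDiff ℝ 2 g ∧
    ∀ x, fderiv ℝ g x (1, 0) = mink n (wedge n (S.F x) (S.W₁ x) z) y ∧
      fderiv ℝ g x (0, 1) = mink n (wedge n (S.F x) (S.W₂ x) z) y := by
  have h₁ := (S.smooth_F.wedge S.smooth_W₁ contDiff_const (h := fun _ => z))
  have h₂ := (S.smooth_F.wedge S.smooth_W₂ contDiff_const (h := fun _ => z))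
  refine exists_primitive ((h₁.mink contDiff_const).of_le (by norm_cast))
    ((h₂.mink contDiff_const).of_le (by norm_cast)) fun x => ?_
  rw [fderiv_mink_const (h₁.differentiable (by simp) x),
    fderiv_mink_const (h₂.differentiable (by simp) x)]
  exact congrArg (fun v => mink n v y) (S.eta_closed x z).symm

/-- The components `((F ∧ F_e) z, y)` of the tangential frame of `Λ ∧ Λ^{(1)}`. -/
def frameComp (z y : MV n) (e x : Surf) : ℝ := mink n (wedge n (S.F x) (pd e S.F x) z) y

/-- The (negative) determinant of the matrix of components of the tangential frame. -/
def frameDet (z y₁ y₂ : MV n) (x : Surf) : ℝ :=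
  S.frameComp z y₂ du x * S.frameComp z y₁ dv x - S.frameComp z y₁ du x * S.frameComp z y₂ dv x

/-- The distortion bound for the components of a primitive of `η`. -/
def distortion (z y₁ y₂ : MV n) (x : Surf) : ℝ :=
  (2 + (4 * gUV n S.F x ^ 2 + gVV n S.F x ^ 2) / gUU n S.F x ^ 2)
    * (S.frameComp z y₁ du x ^ 2 + S.frameComp z y₂ du x ^ 2
      + S.frameComp z y₁ dv x ^ 2 + S.frameComp z y₂ dv x ^ 2) *
    ((gUU n S.F x + gVV n S.F x) * gUU n S.F x /
      ((gUU n S.F x * gVV n S.F x - gUV n S.F x ^ 2) * S.frameDet z y₁ y₂ x))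

lemma gram_pos (x : Surf) :
    0 < gUU n S.F x ∧ 0 < gUU n S.F x * gVV n S.F x - gUV n S.F x ^ 2 :=
  _root_.gram_pos (S.F_null x) (S.mink_pd x du) (S.mink_pd x dv) (S.immersed x)

lemma continuous_frameComp (z y : MV n) (e : Surf) : Continuous (S.frameComp z y e) :=
  (((S.smooth_F.of_le (by norm_cast)).wedge (S.contDiff_pd e) contDiff_const).mink
    contDiff_const).continuous

lemma continuous_frameDet (z y₁ y₂ : MV n) : Continuous (S.frameDet z y₁ y₂) :=
  ((S.continuous_frameComp _ _ _).mul (S.continuous_frameComp _ _ _)).sub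
    ((S.continuous_frameComp _ _ _).mul (S.continuous_frameComp _ _ _))

lemma continuousAt_distortion {z y₁ y₂ : MV n} {x : Surf} (h : 0 < S.frameDet z y₁ y₂ x) :
    ContinuousAt (S.distortion z y₁ y₂) x := by
  have c₁ := (S.continuous_frameComp z y₁ du).continuousAt (x := x)
  have c₂ := (S.continuous_frameComp z y₂ du).continuousAt (x := x)
  have c₃ := (S.continuous_frameComp z y₁ dv).continuousAt (x := x)
  have c₄ := (S.continuous_frameComp z y₂ dv).continuousAt (x := x)
  have c₅ : ContinuousAt (gUU n S.F) x :=
    ((S.contDiff_pd du).mink (S.contDiff_pd du)).continuous.continuousAt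
  have c₆ : ContinuousAt (gUV n S.F) x :=
    ((S.contDiff_pd du).mink (S.contDiff_pd dv)).continuous.continuousAt
  have c₇ : ContinuousAt (gVV n S.F) x :=
    ((S.contDiff_pd dv).mink (S.contDiff_pd dv)).continuous.continuousAt
  have c₈ := (S.continuous_frameDet z y₁ y₂).continuousAt (x := x)
  refine ContinuousAt.mul (ContinuousAt.mul (continuousAt_const.add
    (ContinuousAt.div (by fun_prop) (by fun_prop) (pow_ne_zero 2 (S.gram_pos x).1.ne')))
    (by fun_prop)) (ContinuousAt.div (by fun_prop) (by fun_prop)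
      (mul_ne_zero (S.gram_pos x).2.ne' h.ne'))

lemma eta_quasiregular {z y₁ y₂ : MV n} {x : Surf} (h : 0 < S.frameDet z y₁ y₂ x)
    {D₁₁ D₁₂ D₂₁ D₂₂ : ℝ}
    (h₁₁ : D₁₁ = mink n (wedge n (S.F x) (S.W₁ x) z) y₁)
    (h₁₂ : D₁₂ = mink n (wedge n (S.F x) (S.W₂ x) z) y₁)
    (h₂₁ : D₂₁ = mink n (wedge n (S.F x) (S.W₁ x) z) y₂)
    (h₂₂ : D₂₂ = mink n (wedge n (S.F x) (S.W₂ x) z) y₂) :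
    0 ≤ D₁₁ * D₂₂ - D₁₂ * D₂₁ ∧ (D₁₁ * D₂₂ - D₁₂ * D₂₁ = 0 → x ∈ S.etaZero) ∧
      D₁₁ ^ 2 + D₁₂ ^ 2 + D₂₁ ^ 2 + D₂₂ ^ 2
        ≤ S.distortion z y₁ y₂ x * (D₁₁ * D₂₂ - D₁₂ * D₂₁) := by
  obtain ⟨a, c, d, f₁, f₂, hW₁, hW₂, ha⟩ := S.exists_coeff x
  have w₁ := wedge_of_eq_combination hW₁
  have w₂ := wedge_of_eq_combination
    (show S.W₂ x = a • pd du S.F x + (-c) • pd dv S.F x + f₂ • S.F x by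
      rw [hW₂, neg_smul, sub_eq_add_neg])
  have e₁ : ∀ y, mink n (wedge n (S.F x) (S.W₁ x) z) y
      = c * S.frameComp z y du x + d * S.frameComp z y dv x := fun y => by
    rw [w₁, mink_add_left, mink_smul_left, mink_smul_left]
    rfl
  have e₂ : ∀ y, mink n (wedge n (S.F x) (S.W₂ x) z) y
      = a * S.frameComp z y du x - c * S.frameComp z y dv x := fun y => by
    rw [w₂, mink_add_left, mink_smul_left, mink_smul_left, neg_mul, ← sub_eq_add_neg]
    rfl
  rw [e₁] at h₁₁ h₂₁
  rw [e₂] at h₁₂ h₂₂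
  obtain ⟨s₀, s₁, s₂⟩ := quasiregular_estimate (S.gram_pos x).1 (S.gram_pos x).2 ha h
    (J := D₁₁ * D₂₂ - D₁₂ * D₂₁) (by rw [h₁₁, h₁₂, h₂₁, h₂₂])
  refine ⟨s₀, fun h0 z' => ?_, ?_⟩
  · obtain ⟨ha0, hc, hd⟩ := s₁ h0
    rw [w₁, w₂, hc, hd, ha0]
    simp
  · rw [← h₁₁, ← h₁₂, ← h₂₁, ← h₂₂] at s₂
    exact s₂

lemma mem_interior_etaZero {x₀ : Surf} (hx₀ : x₀ ∈ closure (interior S.etaZero)) :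
    x₀ ∈ interior S.etaZero := by
  obtain ⟨z, hz⟩ := exists_mink_ne_zero (S.F_ne x₀)
  obtain ⟨y₁, hy₁⟩ : ∃ y, y = pd dv S.F x₀ := ⟨_, rfl⟩
  obtain ⟨y₂, hy₂⟩ : ∃ y, y = pd du S.F x₀ := ⟨_, rfl⟩
  obtain ⟨g₁, hg₁, dg₁⟩ := S.exists_eta_primitive z y₁
  obtain ⟨g₂, hg₂, dg₂⟩ := S.exists_eta_primitive z y₂
  have hμ0 : 0 < S.frameDet z y₁ y₂ x₀ := by
    have h := mul_pos (sq_pos_of_ne_zero hz) (S.gram_pos x₀).2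
    simp only [gUU, gUV, gVV] at h
    simp only [frameDet, frameComp, hy₁, hy₂, wedge, mink_sub_left, mink_smul_left, S.mink_pd,
      mink_comm n (pd dv S.F x₀) (pd du S.F x₀)]
    linarith
  obtain ⟨K, hK⟩ : ∃ K, K = |S.distortion z y₁ y₂ x₀| + 1 := ⟨_, rfl⟩
  have hK0 : 0 < K := by rw [hK]; positivity
  have hkK : S.distortion z y₁ y₂ x₀ < K := by rw [hK]; linarith [le_abs_self (S.distortion z y₁ y₂ x₀)]
  obtain ⟨r, hr, hball⟩ := Metric.nhds_basis_closedBall.eventually_iff.mp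
    (((S.continuous_frameDet z y₁ y₂).continuousAt.eventually (lt_mem_nhds hμ0)).and
      ((S.continuousAt_distortion hμ0).eventually (gt_mem_nhds hkK)))
  obtain ⟨a, ha⟩ : ∃ a : ℝ × ℝ, a = (x₀.1 - r, x₀.2 - r) := ⟨_, rfl⟩
  obtain ⟨b, hb⟩ : ∃ b : ℝ × ℝ, b = (x₀.1 + r, x₀.2 + r) := ⟨_, rfl⟩
  have hrect : Metric.closedBall x₀ r = Set.Icc a b := by
    rw [← closedBall_prod_same, Real.closedBall_eq_Icc, Real.closedBall_eq_Icc,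
      Set.Icc_prod_Icc, ha, hb]
  rw [hrect] at hball
  obtain ⟨R, hR⟩ : ∃ R, R = Set.Ioo a.1 b.1 ×ˢ Set.Ioo a.2 b.2 := ⟨_, rfl⟩
  have hRo : IsOpen R := hR ▸ isOpen_Ioo.prod isOpen_Ioo
  have hx₀R : x₀ ∈ R := by
    rw [hR, ha, hb]
    constructor <;> constructor <;> simp [hr]
  have hRI : R ⊆ Set.Icc a b := by
    rw [hR]
    rintro x ⟨hx1, hx2⟩
    exact ⟨⟨hx1.1.le, hx2.1.le⟩, ⟨hx1.2.le, hx2.2.le⟩⟩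
  have hest : ∀ x ∈ Set.Icc a b,
      (fderiv ℝ g₁ x (1, 0) ^ 2 + fderiv ℝ g₁ x (0, 1) ^ 2
        + fderiv ℝ g₂ x (1, 0) ^ 2 + fderiv ℝ g₂ x (0, 1) ^ 2
      ≤ K * (fderiv ℝ g₁ x (1, 0) * fderiv ℝ g₂ x (0, 1)
        - fderiv ℝ g₁ x (0, 1) * fderiv ℝ g₂ x (1, 0))) ∧
      (fderiv ℝ g₁ x (1, 0) * fderiv ℝ g₂ x (0, 1)
        - fderiv ℝ g₁ x (0, 1) * fderiv ℝ g₂ x (1, 0) = 0 → x ∈ S.etaZero) := by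
    intro x hx
    obtain ⟨hμx, hkx⟩ := hball hx
    obtain ⟨s₀, s₁, s₂⟩ := S.eta_quasiregular hμx (dg₁ x).1 (dg₁ x).2 (dg₂ x).1 (dg₂ x).2
    exact ⟨s₂.trans (mul_le_mul_of_nonneg_right hkx.le s₀), s₁⟩
  obtain ⟨p, hpR, hpZ⟩ := mem_closure_iff.mp hx₀ R hRo hx₀R
  obtain ⟨s, hs, hsZ⟩ := Metric.isOpen_iff.mp isOpen_interior p hpZ
  have hloc : ∀ {g : Surf → ℝ} {y : MV n}, ContDiff ℝ 2 g →
      (∀ x, fderiv ℝ g x (1, 0) = mink n (wedge n (S.F x) (S.W₁ x) z) y ∧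
        fderiv ℝ g x (0, 1) = mink n (wedge n (S.F x) (S.W₂ x) z) y) →
      ∀ x ∈ Metric.ball p s, g x - g p = 0 := by
    intro g y hg dg x hx
    rw [sub_eq_zero]
    refine Metric.isOpen_ball.is_const_of_fderiv_eq_zero (convex_ball p s).isPreconnected
      (hg.differentiable two_ne_zero).differentiableOn (fun q hq => ?_) hx
      (Metric.mem_ball_self hs)
    have hq0 := interior_subset (hsZ hq) z
    exact fderiv_eq_zero_of_partials (by rw [(dg q).1, hq0.1, mink_zero_left])
      (by rw [(dg q).2, hq0.2, mink_zero_left])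
  have hconst : ∀ x ∈ R, g₁ x - g₁ p = 0 ∧ g₂ x - g₂ p = 0 := fun x hx =>
    quasiregular_eq_zero (g₁ := fun x => g₁ x - g₁ p) (g₂ := fun x => g₂ x - g₂ p)
      (hg₁.sub contDiff_const) (hg₂.sub contDiff_const) hK0
      (fun x hx => by simpa only [fderiv_sub_const] using (hest x hx).1) (hR ▸ hpR) (hR ▸ hx)
      (Filter.eventually_of_mem (Metric.ball_mem_nhds p hs) fun x hx =>
        ⟨hloc hg₁ dg₁ x hx, hloc hg₂ dg₂ x hx⟩)
  refine mem_interior.mpr ⟨R, fun x hx => (hest x (hRI hx)).2 ?_, hRo, hx₀R⟩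
  have h0 : fderiv ℝ g₁ x = 0 := by
    have : g₁ =ᶠ[nhds x] fun _ => g₁ p :=
      Filter.eventually_of_mem (hRo.mem_nhds hx) fun y hy => sub_eq_zero.mp (hconst y hy).1
    rw [this.fderiv_eq, fderiv_fun_const]
    rfl
  simp [h0]

/-- Weak unique continuation: `η` vanishes on no nonempty open set. -/
lemma dense_compl_etaZero : Dense S.etaZeroᶜ := by
  rw [← interior_eq_empty_iff_dense_compl]
  have hcl : IsClopen (interior S.etaZero) :=
    ⟨isClosed_of_closure_subset fun x hx => S.mem_interior_etaZero hx, isOpen_interior⟩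
  refine (isClopen_iff.mp hcl).resolve_right fun h => ?_
  obtain ⟨x, z, hxz⟩ := S.eta_ne
  have hx : x ∈ S.etaZero := interior_subset (h ▸ Set.mem_univ x)
  rcases hxz with h1 | h1
  · exact h1 (hx z).1
  · exact h1 (hx z).2

lemma mink_eq_zero_of_wedge_eq_zero {p : MV n}
    (h : ∀ x, wedge n (S.F x) (S.W₁ x) p = 0 ∧ wedge n (S.F x) (S.W₂ x) p = 0) (x : Surf) :
    mink n p (S.F x) = 0 := by
  have hc : Continuous fun x => mink n p (S.F x) :=
    (contDiff_const.mink S.smooth_F).continuous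
  refine congrFun (hc.ext_on S.dense_compl_etaZero continuous_const fun y hy => ?_) x
  by_contra hne
  refine hy fun z => ?_
  have hpar : ∀ W, wedge n (S.F y) W p = 0 → wedge n (S.F y) W z = 0 := by
    intro W hW
    have hWF : W = (mink n W p / mink n p (S.F y)) • S.F y := by
      rw [wedge, sub_eq_zero, mink_comm n _ p] at hW
      rw [div_eq_inv_mul, mul_smul, ← hW, smul_smul, inv_mul_cancel₀ hne, one_smul]
    rw [hWF]
    simp only [wedge, mink_smul_left]
    module
  exact ⟨hpar _ (h y).1, hpar _ (h y).2⟩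

lemma spacelike_of_perp {p : MV n} (hp : p ≠ 0) (h : ∀ x, mink n p (S.F x) = 0) :
    0 < mink n p p := by
  have hx := fun x => mink_self_of_perp_null (S.F_ne x) (S.F_null x) ((mink_comm n _ p).trans (h x))
  refine lt_of_le_of_ne (hx 0).1 fun h0 => ?_
  have hFF : ∀ x y, mink n (S.F x) (S.F y) = 0 := by
    intro x y
    obtain ⟨c, hc⟩ := (mink_self_of_perp_null hp h0.symm (h y)).2 (S.F_null y)
    rw [hc, mink_smul_right, mink_comm, h, mul_zero]
  have h1 : ∀ x y, mink n (S.F y) (pd du S.F x) = 0 := by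
    intro x y
    have e := fderiv_mink_const (S.differentiable_F x) (S.F y) du
    rw [show (fun x => mink n (S.F x) (S.F y)) = fun _ => (0 : ℝ) from funext (hFF · y)] at e
    rw [mink_comm]
    simpa [pd] using e.symm
  have h2 : mink n (pd du S.F 0) (pd du S.F 0) = 0 := by
    have e := fderiv_mink_const (S.differentiable_F 0) (pd du S.F 0) du
    rw [show (fun x => mink n (S.F x) (pd du S.F 0)) = fun _ => (0 : ℝ) from
      funext (h1 0 ·)] at e
    simpa [pd] using e.symm
  exact (S.gram_pos 0).1.ne' h2

lemma wedge_eq_zero_of_perp {p : MV n} (h : ∀ x, mink n p (S.F x) = 0) (x : Surf) :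
    wedge n (S.F x) (S.W₁ x) p = 0 ∧ wedge n (S.F x) (S.W₂ x) p = 0 := by
  have hF : ∀ x, mink n (S.F x) p = 0 := fun x => (mink_comm n _ p).trans (h x)
  have hd : ∀ e, mink n (pd e S.F x) p = 0 := by
    intro e
    have h1 := fderiv_mink_const (S.differentiable_F x) p e
    rw [show (fun x => mink n (S.F x) p) = fun _ => (0 : ℝ) from funext hF] at h1
    simpa [pd] using h1.symm
  have hcl := S.closed_expanded x p
  simp only [wedge, hF, hd, zero_smul, zero_sub] at hcl ⊢
  have hli := Fintype.linearIndependent_iff.mp (S.immersed x)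
    ![mink n (fderiv ℝ S.W₁ x dv) p - mink n (fderiv ℝ S.W₂ x du) p, -mink n (S.W₂ x) p,
      mink n (S.W₁ x) p] (by
      simp only [Fin.sum_univ_three, Matrix.cons_val_zero, Matrix.cons_val_one, Matrix.cons_val]
      rw [← sub_eq_zero] at hcl
      rw [← hcl]
      module)
  have e1 : mink n (S.W₁ x) p = 0 := hli 2
  have e2 : -mink n (S.W₂ x) p = 0 := hli 1
  rw [e1, neg_eq_zero.mp e2]
  simp

end IsothermicSurface

/-- An isothermic surface is special isothermic of type `0` if and only if it
is not full, i.e. its image lies in a subsphere `P(L ∩ ⟨p₀⟩^⊥)` for some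
nonzero spacelike `p₀`. -/
theorem special_type_zero_iff_not_full (n : ℕ) (S : IsothermicSurface n) :
    SpecialOfType n S 0 ↔
      ∃ p₀ : MV n, p₀ ≠ 0 ∧ 0 < mink n p₀ p₀ ∧ ∀ x, mink n p₀ (S.F x) = 0 := by
  constructor
  · rintro ⟨q⟩
    have hpar : ∀ t, ParallelSection n S t (q.coeff 0) := fun t => by
      simpa using q.conserved t
    have hconst : ∀ x, q.coeff 0 x = q.coeff 0 0 := fun x =>
      is_const_of_fderiv_eq_zero ((q.smooth 0).differentiable (by simp))
        (fun y => fderiv_eq_zero_of_partials (by simpa [du] using (hpar 0 y).1)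
          (by simpa [dv] using (hpar 0 y).2)) x 0
    have hp : q.coeff 0 0 ≠ 0 := fun h0 => q.top_ne (funext fun x => (hconst x).trans h0)
    have hperp := S.mink_eq_zero_of_wedge_eq_zero (p := q.coeff 0 0) fun x => by
      have h0 := hpar 0 x
      have h1 := hpar 1 x
      simp only [zero_smul, add_zero] at h0
      rw [h0.1, h0.2, hconst x, one_smul, one_smul, zero_add, zero_add] at h1
      exact h1
    exact ⟨q.coeff 0 0, hp, S.spacelike_of_perp hp hperp, hperp⟩
  · rintro ⟨p, hp, -, hperp⟩
    exact ⟨{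
      coeff := fun k _ => if k = 0 then p else 0
      smooth := fun k => contDiff_const
      coeff_eq_zero := fun k hk => by
        funext x
        simp [hk.ne']
      top_ne := fun h => hp (by simpa using congrFun h 0)
      conserved := fun t x => by
        simp [S.wedge_eq_zero_of_perp hperp x] }⟩
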